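/- arXiv:2004.09707 — 2 statements merged into one kernel-verified Lean document; each statement's English description precedes it below -/
import Mathlib

section
/- Let Θ be a continuous ellipsoid cover of ℝⁿ with quasi-distance ρ_Θ and constant γ > 0 such that whenever t ≤ s and θ_{x,t} ∩ θ_{y,s} ≠ ∅ one has θ_{y,s} ⊆ θ_{x,t−γ}. Let s, l ∈ ℕ with l < a₆s/a₄, and 1 < q < ∞. Let T be a bounded linear operator on L^q(ℝⁿ) with kernel K satisfying the order-s VASIO kernel estimate, such that Tf(x) = ∫K(x,y)f(y)dy for a.e. x ∉ supp f whenever f ∈ L^q has compact support. If f ∈ L^q(ℝⁿ) is supported in some ellipsoid θ_{z,t} ∈ Θ and ∫f(x)x^α dx = 0 for all |α| < s, then ∫_{ℝⁿ} |Tf(x)|(1 + |x|^l) dx < ∞. -/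
open MeasureTheory Metric Set Filter ENNReal
noncomputable section

abbrev Euc (n : ℕ) : Type := EuclideanSpace ℝ (Fin n)

structure EllipsoidCover (n : ℕ) where
  M : Euc n → ℝ → (Euc n ≃L[ℝ] Euc n)
  a₁ : ℝ
  a₂ : ℝ
  a₃ : ℝ
  a₄ : ℝ
  a₅ : ℝ
  a₆ : ℝ
  ha₁ : 0 < a₁
  ha₂ : 0 < a₂
  ha₃ : 0 < a₃
  ha₄ : 0 < a₄
  ha₅ : 0 < a₅
  ha₆ : 0 < a₆
  volume_lb : ∀ (x : Euc n) (t : ℝ),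
    a₁ * 2 ^ (-t) ≤ (volume ((fun y => M x t y + x) '' ball 0 1)).toReal
  volume_ub : ∀ (x : Euc n) (t : ℝ),
    (volume ((fun y => M x t y + x) '' ball 0 1)).toReal ≤ a₂ * 2 ^ (-t)
  shape : ∀ (x y : Euc n) (t s : ℝ), 0 ≤ s →
    (((fun v => M x t v + x) '' ball 0 1) ∩ ((fun v => M y (t + s) v + y) '' ball 0 1)).Nonempty →
    a₃ * 2 ^ (-(a₄ * s)) ≤
        1 / ‖((M y (t + s)).symm : Euc n →L[ℝ] Euc n).comp (M x t : Euc n →L[ℝ] Euc n)‖ ∧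
    1 / ‖((M y (t + s)).symm : Euc n →L[ℝ] Euc n).comp (M x t : Euc n →L[ℝ] Euc n)‖ ≤
        ‖((M x t).symm : Euc n →L[ℝ] Euc n).comp (M y (t + s) : Euc n →L[ℝ] Euc n)‖ ∧
    ‖((M x t).symm : Euc n →L[ℝ] Euc n).comp (M y (t + s) : Euc n →L[ℝ] Euc n)‖ ≤
        a₅ * 2 ^ (-(a₆ * s))

namespace EllipsoidCover

variable {n : ℕ}

def θ (Θ : EllipsoidCover n) (x : Euc n) (t : ℝ) : Set (Euc n) :=
  (fun y => Θ.M x t y + x) '' ball 0 1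

def dil (Θ : EllipsoidCover n) (x : Euc n) (t : ℝ) (lam : ℝ) : Set (Euc n) :=
  (fun y => lam • (Θ.M x t y) + x) '' ball 0 1

def ρ (Θ : EllipsoidCover n) (x y : Euc n) : ℝ :=
  sInf {r : ℝ | ∃ (z : Euc n) (t : ℝ), x ∈ Θ.θ z t ∧ y ∈ Θ.θ z t ∧ r = (volume (Θ.θ z t)).toReal}

end EllipsoidCover

/-- The scale `m := −log₂ ρ_Θ(x,y)` associated to a pair of distinct points. -/
def EllipsoidCover.mExp {n : ℕ} (Θ : EllipsoidCover n) (x y : Euc n) : ℝ :=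
  -(Real.logb 2 (Θ.ρ x y))

/-- The order-`s` VASIO kernel estimate with constant `C₀`: the kernel `K(x, ·)` is
`C^s` away from `x`, and for all `x ≠ y` and all multi-indices `|α| ≤ s` (encoded as
iterated directional derivatives along coordinate directions), the rescaled kernel
`v ↦ K(x, M_{y,m} v)`, `m = −log₂ ρ_Θ(x,y)`, satisfies
`|∂^α_v [K(x, M_{y,m} v)]| ≤ C₀ / ρ_Θ(x,y)` at `v = M_{y,m}⁻¹ y`. -/
def KernelEst {n : ℕ} (Θ : EllipsoidCover n) (s : ℕ) (C₀ : ℝ)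
    (K : Euc n → Euc n → ℝ) : Prop :=
  (∀ x : Euc n, ContDiffOn ℝ s (fun y => K x y) {y : Euc n | y ≠ x}) ∧
  ∀ x y : Euc n, x ≠ y → ∀ k : ℕ, k ≤ s → ∀ v : Fin k → Fin n,
    |iteratedFDerivWithin ℝ k (fun w => K x (Θ.M y (Θ.mExp x y) w))
        (⇑(Θ.M y (Θ.mExp x y)).symm '' {w : Euc n | w ≠ x})
        ((Θ.M y (Θ.mExp x y)).symm y)
        (fun j => EuclideanSpace.single (v j) (1 : ℝ))| ≤ C₀ / Θ.ρ x y

open scoped Nat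

lemma exists_mvPolynomial_eval_diag_sub {n k : ℕ}
    (D : ContinuousMultilinearMap ℝ (fun _ : Fin k => Euc n) ℝ) (z : Euc n) :
    ∃ p : MvPolynomial (Fin n) ℝ, p.totalDegree ≤ k ∧
      ∀ y : Euc n, MvPolynomial.eval (fun i => y i) p = D (fun _ => y - z) := by
  refine ⟨∑ v : Fin k → Fin n, (∏ j, (MvPolynomial.X (v j) - MvPolynomial.C (z (v j)))) *
      MvPolynomial.C (D fun j => EuclideanSpace.single (v j) (1 : ℝ)), ?_, fun y => ?_⟩
  · refine MvPolynomial.totalDegree_finsetSum_le fun v _ => ?_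
    refine (MvPolynomial.totalDegree_mul _ _).trans ?_
    rw [MvPolynomial.totalDegree_C, add_zero]
    refine (MvPolynomial.totalDegree_finsetProd _ _).trans ?_
    refine (Finset.sum_le_card_nsmul _ _ 1 fun j _ => ?_).trans (by simp)
    refine (MvPolynomial.totalDegree_sub _ _).trans ?_
    simp
  · have hy : y - z = ∑ i, (y i - z i) • EuclideanSpace.single i (1 : ℝ) := by
      ext j
      simp [Finset.sum_apply, Pi.single_apply]
    rw [hy, D.map_sum]
    simp only [map_sum, map_mul, map_prod, map_sub, MvPolynomial.eval_X, MvPolynomial.eval_C]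
    refine Finset.sum_congr rfl fun v _ => ?_
    rw [D.map_smul_univ]
    simp

lemma abs_sub_sum_iteratedFDeriv_le {n s : ℕ} (hs : 1 ≤ s) {h : Euc n → ℝ} {z u : Euc n} {C : ℝ}
    (hh : ∀ τ ∈ Icc (0 : ℝ) 1, ContDiffAt ℝ s h (z + τ • u))
    (hC : ∀ τ ∈ Icc (0 : ℝ) 1, |iteratedFDeriv ℝ s h (z + τ • u) (fun _ => u)| ≤ C) :
    |h (z + u) - ∑ k ∈ Finset.range s, (k ! : ℝ)⁻¹ * iteratedFDeriv ℝ k h z (fun _ => u)| ≤ C := by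
  obtain ⟨m, rfl⟩ : ∃ m, s = m + 1 := ⟨s - 1, by omega⟩
  rw [map_add_eq_sum_add_integral_iteratedFDeriv (f := h) (x := z) (y := u) (n := m)
    (fun τ hτ => by exact_mod_cast hh τ hτ)]
  simp only [smul_eq_mul, add_sub_cancel_left]
  have hC0 : 0 ≤ C := (abs_nonneg _).trans (hC 0 (by simp))
  have h1 : ‖∫ τ in (0 : ℝ)..1, (1 - τ) ^ m *
      iteratedFDeriv ℝ (m + 1) h (z + τ • u) (fun _ => u)‖ ≤ C * |(1 : ℝ) - 0| := by
    refine intervalIntegral.norm_integral_le_of_norm_le_const fun τ hτ => ?_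
    rw [uIoc_of_le zero_le_one] at hτ
    rw [norm_mul, Real.norm_eq_abs, Real.norm_eq_abs]
    have h2 : |(1 - τ) ^ m| ≤ 1 := by
      rw [abs_pow]
      exact pow_le_one₀ (abs_nonneg _) (abs_le.2 ⟨by linarith [hτ.2], by linarith [hτ.1]⟩)
    calc _ ≤ 1 * C := mul_le_mul h2 (hC τ ⟨hτ.1.le, hτ.2⟩) (abs_nonneg _) zero_le_one
      _ = C := one_mul C
  rw [abs_mul]
  have h3 : |((m ! : ℝ))⁻¹| ≤ 1 := by
    rw [abs_of_nonneg (by positivity)]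
    exact inv_le_one_of_one_le₀ (by exact_mod_cast Nat.factorial_pos m)
  calc _ ≤ 1 * C := mul_le_mul h3 (by simpa using h1) (abs_nonneg _) zero_le_one
    _ = C := one_mul C

lemma integral_mul_mvPolynomial_eval_eq_zero {n s : ℕ} {f : Euc n → ℝ}
    (hint : ∀ g : Euc n → ℝ, Continuous g → Integrable (fun x => f x * g x))
    (hvan : ∀ α : Fin n → ℕ, (∑ i, α i) < s → ∫ x : Euc n, f x * ∏ i, (x i) ^ (α i) = 0)
    {p : MvPolynomial (Fin n) ℝ} (hp : p.totalDegree < s) :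
    ∫ x : Euc n, f x * MvPolynomial.eval (fun i => x i) p = 0 := by
  simp only [MvPolynomial.eval_eq', Finset.mul_sum, mul_left_comm (f _)]
  rw [integral_finsetSum]
  · refine Finset.sum_eq_zero fun d hd => ?_
    rw [integral_const_mul, hvan d, mul_zero]
    refine lt_of_le_of_lt ?_ hp
    have := MvPolynomial.le_totalDegree hd
    rwa [Finsupp.sum_fintype _ _ (fun _ => rfl)] at this
  · intro d _
    exact (hint _ (by fun_prop)).const_mul _

lemma KernelEst.abs_iteratedFDeriv_le {n s : ℕ} {Θ : EllipsoidCover n} {C₀ : ℝ}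
    {K : Euc n → Euc n → ℝ} (hK : KernelEst Θ s C₀ K) {x y w : Euc n} (hxy : x ≠ y)
    {c : ℝ} (hw : ‖w‖ ≤ c) :
    |iteratedFDeriv ℝ s (K x) y (fun _ => Θ.M y (Θ.mExp x y) w)| ≤
      (n : ℝ) ^ s * (c ^ s * (C₀ / Θ.ρ x y)) := by
  set A := Θ.M y (Θ.mExp x y) with hA
  have hU : IsOpen {y : Euc n | y ≠ x} := isOpen_ne
  have key : ∀ v : Fin s → Fin n, |iteratedFDeriv ℝ s (K x) y
      (fun j => A (EuclideanSpace.single (v j) (1 : ℝ)))| ≤ C₀ / Θ.ρ x y := by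
    intro v
    have h1 := hK.2 x y hxy s le_rfl v
    rw [← hA, ContinuousLinearEquiv.image_symm_eq_preimage] at h1
    have h2 := A.iteratedFDerivWithin_comp_right (K x) hU.uniqueDiffOn
      (x := A.symm y) (by simpa using hxy.symm) s
    have h3 : (fun w => K x (A w)) = K x ∘ A := rfl
    rw [h3, h2, A.apply_symm_apply, iteratedFDerivWithin_of_isOpen s hU hxy.symm] at h1
    simpa using h1
  have hwsum : A w = ∑ i, w i • A (EuclideanSpace.single i (1 : ℝ)) := by
    have : w = ∑ i, w i • EuclideanSpace.single i (1 : ℝ) := by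
      ext j
      simp [Finset.sum_apply, Pi.single_apply]
    conv_lhs => rw [this]
    simp
  rw [hwsum, ContinuousMultilinearMap.map_sum]
  refine (Finset.abs_sum_le_sum_abs _ _).trans ?_
  refine (Finset.sum_le_card_nsmul _ _ (c ^ s * (C₀ / Θ.ρ x y)) fun v _ => ?_).trans ?_
  · rw [ContinuousMultilinearMap.map_smul_univ, smul_eq_mul, abs_mul]
    refine mul_le_mul ?_ (key v) (abs_nonneg _)
      (pow_nonneg ((norm_nonneg _).trans hw) _)
    rw [Finset.abs_prod]
    refine (Finset.prod_le_prod (g := fun _ => c) (fun _ _ => abs_nonneg _)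
      fun j _ => ?_).trans (by simp)
    exact (PiLp.norm_apply_le w (v j)).trans hw
  · simp

namespace EllipsoidCover

variable {n : ℕ} (Θ : EllipsoidCover n)

lemma mem_θ_iff {x z : Euc n} {t : ℝ} : x ∈ Θ.θ z t ↔ ‖(Θ.M z t).symm (x - z)‖ < 1 := by
  constructor
  · rintro ⟨v, hv, rfl⟩
    simpa using hv
  · intro h
    exact ⟨(Θ.M z t).symm (x - z), by simpa using h, by simp⟩

lemma self_mem_θ (z : Euc n) (t : ℝ) : z ∈ Θ.θ z t := by
  simp [mem_θ_iff]

lemma isOpen_θ (z : Euc n) (t : ℝ) : IsOpen (Θ.θ z t) := by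
  have : Θ.θ z t = (fun x => ‖(Θ.M z t).symm (x - z)‖) ⁻¹' Iio 1 := by
    ext x
    exact Θ.mem_θ_iff
  rw [this]
  exact isOpen_Iio.preimage (by fun_prop)

lemma norm_symm_comp_le {x y w : Euc n} {t s : ℝ} (hts : t ≤ s) (hx : w ∈ Θ.θ x t)
    (hy : w ∈ Θ.θ y s) :
    ‖((Θ.M x t).symm : Euc n →L[ℝ] Euc n).comp (Θ.M y s : Euc n →L[ℝ] Euc n)‖ ≤
      Θ.a₅ * 2 ^ (-(Θ.a₆ * (s - t))) := by
  have h := (Θ.shape x y t (s - t) (by linarith) ⟨w, hx, by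
    rw [add_sub_cancel]
    exact hy⟩).2.2
  rwa [add_sub_cancel] at h

lemma norm_symm_comp_le' {x y w : Euc n} {t s : ℝ} (hts : t ≤ s) (hx : w ∈ Θ.θ x t)
    (hy : w ∈ Θ.θ y s) :
    ‖((Θ.M y s).symm : Euc n →L[ℝ] Euc n).comp (Θ.M x t : Euc n →L[ℝ] Euc n)‖ ≤
      Θ.a₃⁻¹ * 2 ^ (Θ.a₄ * (s - t)) := by
  have h := (Θ.shape x y t (s - t) (by linarith) ⟨w, hx, by
    rw [add_sub_cancel]
    exact hy⟩).1
  rw [add_sub_cancel] at h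
  have h0 : 0 < Θ.a₃ * 2 ^ (-(Θ.a₄ * (s - t))) := mul_pos Θ.ha₃ (by positivity)
  have h1 := inv_anti₀ h0 h
  rwa [one_div, inv_inv, mul_inv, Real.rpow_neg zero_le_two, inv_inv] at h1

lemma norm_le_of_mem_θ {x z : Euc n} {t κ : ℝ} (hκ : 0 ≤ κ) (hx : x ∈ Θ.θ z (t - κ)) :
    ‖x‖ ≤ ‖z‖ + ‖(Θ.M z t : Euc n →L[ℝ] Euc n)‖ * (Θ.a₃⁻¹ * 2 ^ (Θ.a₄ * κ)) := by
  obtain ⟨v, hv, rfl⟩ := hx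
  have h := Θ.norm_symm_comp_le' (x := z) (y := z) (w := z) (t := t - κ) (s := t) (by linarith)
    (Θ.self_mem_θ _ _) (Θ.self_mem_θ _ _)
  rw [_root_.sub_sub_cancel] at h
  have hv1 : ‖v‖ ≤ 1 := by
    have : ‖v‖ < 1 := by simpa using hv
    exact this.le
  have h1 : Θ.M z (t - κ) v = (Θ.M z t : Euc n →L[ℝ] Euc n)
      ((((Θ.M z t).symm : Euc n →L[ℝ] Euc n).comp (Θ.M z (t - κ) : Euc n →L[ℝ] Euc n)) v) := by
    simp
  rw [add_comm]
  refine (norm_add_le _ _).trans (add_le_add ?_ le_rfl)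
  rw [h1]
  refine (ContinuousLinearMap.le_opNorm _ _).trans
    (mul_le_mul_of_nonneg_left ?_ (norm_nonneg _))
  refine (ContinuousLinearMap.le_opNorm _ _).trans ?_
  calc _ ≤ _ * 1 := mul_le_mul_of_nonneg_left hv1 (norm_nonneg _)
    _ ≤ _ := by rwa [mul_one]

lemma exists_mem_θ (z x : Euc n) (t κ : ℝ) : ∃ i : ℕ, x ∈ Θ.θ z (t - (κ + i)) := by
  have hr : (2 : ℝ) ^ (-Θ.a₆) < 1 := Real.rpow_lt_one_of_one_lt_of_neg one_lt_two (by
    linarith [Θ.ha₆])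
  set c := ‖(Θ.M z (t - κ)).symm (x - z)‖ with hc
  have hlim : Tendsto (fun i : ℕ => Θ.a₅ * ((2 : ℝ) ^ (-Θ.a₆)) ^ i * c) atTop
      (nhds (Θ.a₅ * 0 * c)) :=
    ((tendsto_pow_atTop_nhds_zero_of_lt_one (by positivity) hr).const_mul _).mul_const _
  rw [mul_zero, zero_mul] at hlim
  obtain ⟨i, hi⟩ := (hlim.eventually (gt_mem_nhds one_pos)).exists
  refine ⟨i, Θ.mem_θ_iff.2 (lt_of_le_of_lt ?_ hi)⟩
  have h := Θ.norm_symm_comp_le (x := z) (y := z) (w := z) (t := t - (κ + i)) (s := t - κ)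
    (by linarith [(Nat.cast_nonneg i : (0 : ℝ) ≤ i)]) (Θ.self_mem_θ _ _) (Θ.self_mem_θ _ _)
  have h1 : (Θ.M z (t - (κ + i))).symm (x - z) =
      (((Θ.M z (t - (κ + i))).symm : Euc n →L[ℝ] Euc n).comp
        (Θ.M z (t - κ) : Euc n →L[ℝ] Euc n)) ((Θ.M z (t - κ)).symm (x - z)) := by
    simp
  rw [h1]
  refine (ContinuousLinearMap.le_opNorm _ _).trans
    (mul_le_mul_of_nonneg_right (h.trans_eq ?_) (norm_nonneg _))
  rw [← Real.rpow_mul_natCast zero_le_two]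
  congr 2
  ring

lemma isBounded_θ (z : Euc n) (t : ℝ) : Bornology.IsBounded (Θ.θ z t) := by
  refine isBounded_iff_forall_norm_le.2 ⟨_, fun x hx =>
    Θ.norm_le_of_mem_θ (z := z) (t := t) le_rfl ?_⟩
  rwa [sub_zero]

lemma convex_θ (z : Euc n) (t : ℝ) : Convex ℝ (Θ.θ z t) := by
  have : Θ.θ z t = (fun v => v + z) '' ((Θ.M z t : Euc n →ₗ[ℝ] Euc n) '' ball 0 1) := by
    rw [θ, image_image]
    rfl
  rw [this]
  simpa only [add_comm _ z] using ((convex_ball (0 : Euc n) 1).linear_image _).translate z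

/-- The inner property of the cover: an ellipsoid meeting one of a coarser scale is contained
in its `γ`-enlargement. -/
def Inner (γ : ℝ) : Prop :=
  ∀ (x y : Euc n) (t s : ℝ), t ≤ s → (Θ.θ x t ∩ Θ.θ y s).Nonempty → Θ.θ y s ⊆ Θ.θ x (t - γ)

variable {Θ}

lemma Inner.subset {γ : ℝ} (h : Θ.Inner γ) (z : Euc n) {t κ : ℝ} (hκ : γ ≤ κ) :
    Θ.θ z t ⊆ Θ.θ z (t - κ) := by
  have := h z z (t - (κ - γ)) t (by linarith) ⟨z, Θ.self_mem_θ _ _, Θ.self_mem_θ _ _⟩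
  rwa [sub_sub, sub_add_cancel] at this

lemma Inner.le_ρ {γ : ℝ} (h : Θ.Inner γ) (hγ : 0 < γ) {x y z : Euc n} {t k : ℝ} (hk : 0 ≤ k)
    (hx : x ∉ Θ.θ z (t - (2 * γ + k))) (hy : y ∈ Θ.θ z t) : Θ.a₁ * 2 ^ (k - t) ≤ Θ.ρ x y := by
  refine le_csInf ?_ ?_
  · obtain ⟨i, hi⟩ := Θ.exists_mem_θ z x t (2 * γ + k)
    exact ⟨_, z, _, hi, h.subset z (by linarith [(Nat.cast_nonneg i : (0 : ℝ) ≤ i)]) hy, rfl⟩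
  · rintro r ⟨w, u, hxw, hyw, rfl⟩
    refine le_trans ?_ (Θ.volume_lb w u)
    refine mul_le_mul_of_nonneg_left (Real.rpow_le_rpow_of_exponent_le one_le_two ?_) Θ.ha₁.le
    by_contra! hu
    refine hx ?_
    have h1 := h z w (t - (γ + k)) u (by linarith)
      ⟨y, h.subset z (by linarith) hy, hyw⟩ hxw
    rwa [sub_sub, show γ + k + γ = 2 * γ + k by ring] at h1

end EllipsoidCover

section FarBound

variable {n s : ℕ} {Θ : EllipsoidCover n} {γ C₀ : ℝ} {K : Euc n → Euc n → ℝ}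

lemma KernelEst.abs_iteratedFDeriv_le_of_far (hK : KernelEst Θ s C₀ K) (hC₀ : 0 < C₀)
    (hΘ : Θ.Inner γ) (hγ : 0 < γ) {x y u z : Euc n} {t k : ℝ} (hk : 0 ≤ k)
    (hk' : 0 ≤ k + Real.logb 2 Θ.a₁)
    (hx : x ∉ Θ.θ z (t - (2 * γ + k))) (hy : y ∈ Θ.θ z t) (hu : z + u ∈ Θ.θ z t) :
    |iteratedFDeriv ℝ s (K x) y (fun _ => u)| ≤ (n : ℝ) ^ s *
      ((Θ.a₅ * 2 ^ (-(Θ.a₆ * (k + Real.logb 2 Θ.a₁)))) ^ s * (C₀ / (Θ.a₁ * 2 ^ (k - t)))) := by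
  have hxy : x ≠ y := by
    rintro rfl
    exact hx (hΘ.subset z (by linarith) hy)
  have hle := hΘ.le_ρ hγ hk hx hy
  have hpos : 0 < Θ.a₁ * 2 ^ (k - t) := mul_pos Θ.ha₁ (by positivity)
  have hm : Real.logb 2 Θ.a₁ + (k - t) ≤ Real.logb 2 (Θ.ρ x y) := by
    have := Real.logb_le_logb_of_le one_lt_two hpos hle
    rwa [Real.logb_mul Θ.ha₁.ne' (by positivity), Real.logb_rpow two_pos (by norm_num)] at this
  set A := Θ.M y (Θ.mExp x y) with hA
  have hmt : k + Real.logb 2 Θ.a₁ ≤ t - Θ.mExp x y := by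
    rw [EllipsoidCover.mExp]
    linarith
  have hw : ‖A.symm u‖ ≤ Θ.a₅ * 2 ^ (-(Θ.a₆ * (k + Real.logb 2 Θ.a₁))) := by
    have h1 := Θ.norm_symm_comp_le (x := y) (y := z) (w := y) (t := Θ.mExp x y) (s := t)
      (by linarith) (Θ.self_mem_θ _ _) hy
    have hv : ‖(Θ.M z t).symm u‖ ≤ 1 := by
      have := Θ.mem_θ_iff.1 hu
      rw [add_sub_cancel_left] at this
      exact this.le
    have h2 : A.symm u = ((A.symm : Euc n →L[ℝ] Euc n).comp (Θ.M z t : Euc n →L[ℝ] Euc n))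
        ((Θ.M z t).symm u) := by
      simp
    rw [h2]
    calc _ ≤ _ * ‖(Θ.M z t).symm u‖ := ContinuousLinearMap.le_opNorm _ _
      _ ≤ _ * 1 := mul_le_mul_of_nonneg_left hv (norm_nonneg _)
      _ ≤ _ := by rwa [mul_one]
      _ ≤ _ := mul_le_mul_of_nonneg_left (Real.rpow_le_rpow_of_exponent_le one_le_two
          (neg_le_neg (mul_le_mul_of_nonneg_left hmt Θ.ha₆.le))) Θ.ha₅.le
  have h3 := hK.abs_iteratedFDeriv_le hxy hw
  rw [← hA, A.apply_symm_apply] at h3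
  refine h3.trans (mul_le_mul_of_nonneg_left (mul_le_mul_of_nonneg_left ?_ ?_) (by positivity))
  · exact div_le_div_of_nonneg_left hC₀.le hpos hle
  · exact pow_nonneg (mul_nonneg Θ.ha₅.le (by positivity)) _

lemma KernelEst.abs_integral_le_of_far (hK : KernelEst Θ s C₀ K) (hC₀ : 0 < C₀) (hs : 1 ≤ s)
    (hΘ : Θ.Inner γ) (hγ : 0 < γ) {x z : Euc n} {t k : ℝ} (hk : 0 ≤ k)
    (hk' : 0 ≤ k + Real.logb 2 Θ.a₁) (hx : x ∉ Θ.θ z (t - (2 * γ + k))) {f : Euc n → ℝ}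
    (hint : ∀ g : Euc n → ℝ, Continuous g → Integrable (fun y => f y * g y))
    (hsupp : ∀ᵐ y ∂volume, y ∉ Θ.θ z t → f y = 0)
    (hvan : ∀ α : Fin n → ℕ, (∑ i, α i) < s → ∫ y : Euc n, f y * ∏ i, (y i) ^ (α i) = 0) :
    |∫ y, K x y * f y| ≤ (n : ℝ) ^ s *
      ((Θ.a₅ * 2 ^ (-(Θ.a₆ * (k + Real.logb 2 Θ.a₁)))) ^ s * (C₀ / (Θ.a₁ * 2 ^ (k - t)))) *
      ∫ y, |f y| := by
  set C := (n : ℝ) ^ s *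
      ((Θ.a₅ * 2 ^ (-(Θ.a₆ * (k + Real.logb 2 Θ.a₁)))) ^ s * (C₀ / (Θ.a₁ * 2 ^ (k - t)))) with hC
  have hC0 : 0 ≤ C := by
    have := Θ.ha₅
    have := Θ.ha₁
    positivity
  choose p hpdeg hp using fun j : ℕ =>
    exists_mvPolynomial_eval_diag_sub (iteratedFDeriv ℝ j (K x) z) z
  set P : MvPolynomial (Fin n) ℝ :=
    ∑ j ∈ Finset.range s, MvPolynomial.C ((j ! : ℝ)⁻¹) * p j with hP
  have hPdeg : P.totalDegree < s := by
    refine Nat.lt_of_le_sub_one hs (MvPolynomial.totalDegree_finsetSum_le fun j hj => ?_)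
    refine (MvPolynomial.totalDegree_mul _ _).trans ?_
    rw [MvPolynomial.totalDegree_C, zero_add]
    exact (hpdeg j).trans (Nat.le_sub_one_of_lt (Finset.mem_range.1 hj))
  have hPeval : ∀ y : Euc n, MvPolynomial.eval (fun i => y i) P =
      ∑ j ∈ Finset.range s, (j ! : ℝ)⁻¹ * iteratedFDeriv ℝ j (K x) z (fun _ => y - z) := by
    intro y
    rw [hP, map_sum]
    refine Finset.sum_congr rfl fun j _ => ?_
    rw [map_mul, MvPolynomial.eval_C, hp]
  have htaylor : ∀ y ∈ Θ.θ z t, |K x y - MvPolynomial.eval (fun i => y i) P| ≤ C := by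
    intro y hy
    have hseg : ∀ τ ∈ Icc (0 : ℝ) 1, z + τ • (y - z) ∈ Θ.θ z t := fun τ hτ =>
      (Θ.convex_θ z t).add_smul_sub_mem (Θ.self_mem_θ z t) hy hτ
    have h := abs_sub_sum_iteratedFDeriv_le (h := K x) (z := z) (u := y - z) (C := C) hs
      (fun τ hτ => ?_) (fun τ hτ => ?_)
    · rwa [add_sub_cancel, ← hPeval] at h
    · refine (hK.1 x).contDiffAt (isOpen_ne.mem_nhds ?_)
      rintro h
      exact hx (hΘ.subset z (by linarith) (h ▸ hseg τ hτ))
    · exact hK.abs_iteratedFDeriv_le_of_far hC₀ hΘ hγ hk hk' hx (hseg τ hτ)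
        (by rwa [add_sub_cancel])
  have hf1 : Integrable f := by simpa using hint (fun _ => 1) continuous_const
  by_cases hKf : Integrable fun y => K x y * f y
  · have h1 : ∫ y, K x y * f y =
        ∫ y, (K x y * f y - f y * MvPolynomial.eval (fun i => y i) P) := by
      rw [integral_sub hKf (hint _ ?_), integral_mul_mvPolynomial_eval_eq_zero hint hvan hPdeg,
        sub_zero]
      simp only [MvPolynomial.eval_eq']
      fun_prop
    rw [h1, ← integral_const_mul, ← Real.norm_eq_abs]
    refine norm_integral_le_of_norm_le (hf1.abs.const_mul C) ?_
    filter_upwards [hsupp] with y hy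
    by_cases hyθ : y ∈ Θ.θ z t
    · rw [mul_comm (f y), ← sub_mul, norm_mul]
      exact mul_le_mul_of_nonneg_right (htaylor y hyθ) (abs_nonneg _)
    · simp [hy hyθ]
  · rw [integral_undef hKf, abs_zero]
    exact mul_nonneg hC0 (integral_nonneg fun _ => abs_nonneg _)

end FarBound

lemma MeasureTheory.MemLp.integrableOn_of_isBounded {n : ℕ} {q : ℝ≥0∞} [hq : Fact (1 ≤ q)]
    {g : Euc n → ℝ} (hg : MemLp g q volume) {A : Set (Euc n)} (hA : Bornology.IsBounded A) :
    IntegrableOn g A := by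
  have : IsFiniteMeasure (volume.restrict A) :=
    isFiniteMeasure_restrict.2 hA.measure_lt_top.ne
  exact memLp_one_iff_integrable.1 ((hg.restrict A).mono_exponent hq.out)

/-- Let `Θ` be a continuous ellipsoid cover with `γ > 0` as usual,
`s, l ∈ ℕ` with `l < a₆ s / a₄`, `1 < q < ∞`, and let `T` be a bounded linear operator
on `L^q(ℝⁿ)` with kernel `K` satisfying the order-`s` VASIO estimate, representing `T`
by `Tf(x) = ∫ K(x,y) f(y) dy` a.e. off the (compact) support of any compactly supported
`f ∈ L^q`.  If `f ∈ L^q` is supported in an ellipsoid `θ_{z,t}` and has vanishing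
moments of order `< s`, then `∫ |Tf(x)| (1 + |x|^l) dx < ∞`. -/
theorem stmt13 (n : ℕ) (Θ : EllipsoidCover n) (γ : ℝ) (hγ : 0 < γ)
    (hincl : ∀ (x y : Euc n) (t s : ℝ), t ≤ s → (Θ.θ x t ∩ Θ.θ y s).Nonempty →
      Θ.θ y s ⊆ Θ.θ x (t - γ))
    (s l : ℕ) (hs : 1 ≤ s) (hl : 1 ≤ l) (hls : (l : ℝ) < Θ.a₆ * s / Θ.a₄)
    (q : ℝ) (hq : 1 < q) [Fact (1 ≤ ENNReal.ofReal q)]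
    (T : Lp ℝ (ENNReal.ofReal q) (volume : Measure (Euc n)) →L[ℝ]
         Lp ℝ (ENNReal.ofReal q) (volume : Measure (Euc n)))
    (K : Euc n → Euc n → ℝ) (C₀ : ℝ) (hC₀ : 0 < C₀) (hK : KernelEst Θ s C₀ K)
    (hrep : ∀ (f : Lp ℝ (ENNReal.ofReal q) (volume : Measure (Euc n))) (E : Set (Euc n)),
      IsCompact E → (∀ᵐ x ∂volume, x ∉ E → f x = 0) →
      ∀ᵐ x ∂volume, x ∉ E → T f x = ∫ y : Euc n, K x y * f y)
    (f : Lp ℝ (ENNReal.ofReal q) (volume : Measure (Euc n)))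
    (z : Euc n) (t : ℝ)
    (hsupp : ∀ᵐ x ∂volume, x ∉ Θ.θ z t → f x = 0)
    (hvan : ∀ α : Fin n → ℕ, (∑ i, α i) < s →
      ∫ x : Euc n, f x * ∏ i, (x i) ^ (α i) = 0) :
    ∫⁻ x : Euc n, ENNReal.ofReal (|T f x| * (1 + ‖x‖ ^ l)) < ⊤ := by
  have hΘ : Θ.Inner γ := hincl
  have ha₁ := Θ.ha₁
  have ha₂ := Θ.ha₂
  have ha₃ := Θ.ha₃
  have ha₅ := Θ.ha₅
  have hE : IsCompact (closure (Θ.θ z t)) := (Θ.isBounded_θ z t).isCompact_closure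
  have hsuppE : ∀ᵐ x ∂volume, x ∉ closure (Θ.θ z t) → f x = 0 := by
    filter_upwards [hsupp] with x hx hxE
    exact hx fun h => hxE (subset_closure h)
  have hint : ∀ g : Euc n → ℝ, Continuous g → Integrable (fun y => f y * g y) := by
    intro g hg
    refine (((Lp.memLp f).integrableOn_of_isBounded hE.isBounded).mul_continuousOn
      hg.continuousOn hE).integrable_of_ae_notMem_eq_zero ?_
    filter_upwards [hsuppE] with x hx hxE
    rw [hx hxE, zero_mul]
  set L := Real.logb 2 Θ.a₁ with hL
  set k₀ := |L| with hk₀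
  set S : ℕ → Set (Euc n) := fun i => Θ.θ z (t - (2 * γ + (k₀ + i))) with hS
  set N := ∫ y, |f y| with hN
  have hN0 : 0 ≤ N := integral_nonneg fun _ => abs_nonneg _
  set m := ‖(Θ.M z t : Euc n →L[ℝ] Euc n)‖ with hm
  set D : ℝ := ‖z‖ + m * (Θ.a₃⁻¹ * 2 ^ (Θ.a₄ * (2 * γ + k₀ + 1))) with hD
  have hD0 : 0 ≤ D := by positivity
  set B : ℝ := (n : ℝ) ^ s * ((Θ.a₅ * 2 ^ (-(Θ.a₆ * (k₀ + L)))) ^ s *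
    (C₀ / (Θ.a₁ * 2 ^ (k₀ - t)))) * N * (1 + D ^ l) with hB
  have hB0 : 0 ≤ B := by positivity
  set V : ℝ := Θ.a₂ * 2 ^ (2 * γ + k₀ + 1 - t) with hV
  have hpt : ∀ᵐ x ∂volume, ∀ i : ℕ, x ∈ (S (i + 1) \ S i) \ closure (Θ.θ z t) →
      |T f x| * (1 + ‖x‖ ^ l) ≤
        B * ((2 ^ (-(Θ.a₆ * i))) ^ s * (2 ^ (Θ.a₄ * i)) ^ l / 2 ^ (i : ℝ)) := by
    filter_upwards [hrep f _ hE hsuppE] with x hTx i hx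
    have hi : (0 : ℝ) ≤ i := Nat.cast_nonneg i
    have hk₀' : 0 ≤ k₀ := abs_nonneg _
    have h1 := hK.abs_integral_le_of_far hC₀ hs hΘ hγ (k := k₀ + i) (by positivity)
      (by linarith [neg_abs_le L]) hx.1.2 hint hsupp hvan
    rw [← hTx hx.2] at h1
    have e1 : (2 : ℝ) ^ (-(Θ.a₆ * (k₀ + i + L))) =
        2 ^ (-(Θ.a₆ * (k₀ + L))) * 2 ^ (-(Θ.a₆ * i)) := by
      rw [← Real.rpow_add two_pos]
      congr 1
      ring
    have e2 : (2 : ℝ) ^ (k₀ + i - t) = 2 ^ (k₀ - t) * 2 ^ (i : ℝ) := by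
      rw [← Real.rpow_add two_pos]
      congr 1
      ring
    have h2 : ‖x‖ ≤ D * 2 ^ (Θ.a₄ * i) := by
      have hX : (1 : ℝ) ≤ 2 ^ (Θ.a₄ * i) :=
        Real.one_le_rpow one_le_two (mul_nonneg Θ.ha₄.le hi)
      refine (Θ.norm_le_of_mem_θ (by positivity) hx.1.1).trans ?_
      have e3 : (2 : ℝ) ^ (Θ.a₄ * (2 * γ + (k₀ + ((i + 1 : ℕ) : ℝ)))) =
          2 ^ (Θ.a₄ * (2 * γ + k₀ + 1)) * 2 ^ (Θ.a₄ * i) := by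
        rw [← Real.rpow_add two_pos]
        congr 1
        push_cast
        ring
      rw [e3, hD, add_mul]
      refine add_le_add (le_mul_of_one_le_right (norm_nonneg _) hX) (le_of_eq ?_)
      ring
    have h3 : 1 + ‖x‖ ^ l ≤ (1 + D ^ l) * (2 ^ (Θ.a₄ * i)) ^ l := by
      have hX : (1 : ℝ) ≤ (2 ^ (Θ.a₄ * i)) ^ l :=
        one_le_pow₀ (Real.one_le_rpow one_le_two (mul_nonneg Θ.ha₄.le hi))
      rw [add_mul, one_mul, ← mul_pow]
      exact add_le_add hX (pow_le_pow_left₀ (norm_nonneg _) h2 l)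
    refine (mul_le_mul h1 h3 (by positivity) ((abs_nonneg _).trans h1)).trans_eq ?_
    rw [← hL, ← hN, e1, e2, hB]
    field_simp
    ring
  have hvol : ∀ i : ℕ, volume (S (i + 1)) ≤ ENNReal.ofReal (V * 2 ^ (i : ℝ)) := by
    intro i
    have hfin : volume (S (i + 1)) ≠ ⊤ := (Θ.isBounded_θ z _).measure_lt_top.ne
    rw [← ENNReal.ofReal_toReal hfin]
    refine ENNReal.ofReal_le_ofReal ((Θ.volume_ub z _).trans_eq ?_)
    rw [hV, mul_assoc, ← Real.rpow_add two_pos]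
    congr 2
    push_cast
    ring
  set r : ℝ := 2 ^ (Θ.a₄ * l - Θ.a₆ * s) with hr
  have hr1 : r < 1 := by
    refine Real.rpow_lt_one_of_one_lt_of_neg one_lt_two ?_
    rw [lt_div_iff₀ Θ.ha₄] at hls
    linarith
  have hfar : ∀ i : ℕ, ∫⁻ x in (S (i + 1) \ S i) \ closure (Θ.θ z t),
      ENNReal.ofReal (|T f x| * (1 + ‖x‖ ^ l)) ≤ ENNReal.ofReal (B * V * r ^ i) := by
    intro i
    have hmeas : MeasurableSet ((S (i + 1) \ S i) \ closure (Θ.θ z t)) :=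
      ((Θ.isOpen_θ z _).measurableSet.diff (Θ.isOpen_θ z _).measurableSet).diff
        isClosed_closure.measurableSet
    set c : ℝ := B * ((2 ^ (-(Θ.a₆ * i))) ^ s * (2 ^ (Θ.a₄ * i)) ^ l / 2 ^ (i : ℝ)) with hc
    calc _ ≤ ∫⁻ _ in (S (i + 1) \ S i) \ closure (Θ.θ z t), ENNReal.ofReal c :=
          setLIntegral_mono_ae' hmeas <| by
            filter_upwards [hpt] with x hx hxi
            exact ENNReal.ofReal_le_ofReal (hx i hxi)
      _ = ENNReal.ofReal c * volume ((S (i + 1) \ S i) \ closure (Θ.θ z t)) :=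
          setLIntegral_const _ _
      _ ≤ ENNReal.ofReal c * ENNReal.ofReal (V * 2 ^ (i : ℝ)) := by
          gcongr
          exact (measure_mono (sdiff_subset.trans sdiff_subset)).trans (hvol i)
      _ = ENNReal.ofReal (B * V * r ^ i) := by
          rw [← ENNReal.ofReal_mul (by positivity)]
          congr 1
          have e : r ^ i = (2 ^ (-(Θ.a₆ * i))) ^ s * (2 ^ (Θ.a₄ * i)) ^ l := by
            rw [hr, ← Real.rpow_mul_natCast zero_le_two, ← Real.rpow_mul_natCast zero_le_two,
              ← Real.rpow_mul_natCast zero_le_two, ← Real.rpow_add two_pos]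
            congr 1
            ring
          rw [e, hc]
          field_simp
  have hnear : ∫⁻ x in S 0 ∪ closure (Θ.θ z t),
      ENNReal.ofReal (|T f x| * (1 + ‖x‖ ^ l)) < ⊤ := by
    have hbdd : Bornology.IsBounded (S 0 ∪ closure (Θ.θ z t)) :=
      (Θ.isBounded_θ z _).union hE.isBounded
    obtain ⟨R, hR⟩ := isBounded_iff_forall_norm_le.1 hbdd
    have hmeas : MeasurableSet (S 0 ∪ closure (Θ.θ z t)) :=
      (Θ.isOpen_θ z _).measurableSet.union isClosed_closure.measurableSet
    refine (setLIntegral_mono' hmeas fun x hx => ENNReal.ofReal_le_ofReal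
      (mul_le_mul_of_nonneg_left (b := 1 + ‖x‖ ^ l) (c := 1 + R ^ l) ?_ (abs_nonneg _))).trans_lt
      (((Lp.memLp (T f)).integrableOn_of_isBounded hbdd).abs.mul_const
        (1 + R ^ l)).lintegral_lt_top
    exact add_le_add le_rfl (pow_le_pow_left₀ (norm_nonneg _) (hR x hx) l)
  have hcover : (S 0 ∪ closure (Θ.θ z t)) ∪
      ⋃ i : ℕ, (S (i + 1) \ S i) \ closure (Θ.θ z t) = univ := by
    refine eq_univ_of_forall fun x => ?_
    by_cases hx0 : x ∈ S 0 ∪ closure (Θ.θ z t)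
    · exact Or.inl hx0
    refine Or.inr ?_
    rw [mem_union, not_or] at hx0
    have hex : ∃ i, x ∈ S i := by
      obtain ⟨i, hi⟩ := Θ.exists_mem_θ z x t (2 * γ + k₀)
      exact ⟨i, by rwa [add_assoc] at hi⟩
    classical
    obtain ⟨j, hj⟩ : ∃ j, Nat.find hex = j + 1 := Nat.exists_eq_succ_of_ne_zero fun h0 =>
      hx0.1 (h0 ▸ Nat.find_spec hex)
    exact mem_iUnion.2 ⟨j, ⟨hj ▸ Nat.find_spec hex, Nat.find_min hex (by omega)⟩, hx0.2⟩
  rw [← setLIntegral_univ, ← hcover]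
  refine (lintegral_union_le _ _ _).trans_lt (ENNReal.add_lt_top.2 ⟨hnear, ?_⟩)
  refine (lintegral_iUnion_le _ _).trans_lt ((ENNReal.tsum_le_tsum hfar).trans_lt ?_)
  exact ((summable_geometric_of_lt_one (by positivity) hr1).mul_left
    (B * V)).tsum_ofReal_lt_top
end
end

section
/- Let Θ be a continuous ellipsoid cover of ℝⁿ with constant γ > 0 such that whenever t ≤ s and θ_{x,t} ∩ θ_{y,s} ≠ ∅ one has θ_{y,s} ⊆ θ_{x,t−γ}. Let (p,q,l) be admissible (0 < p ≤ 1 ≤ q ≤ ∞, p < q, l ∈ ℕ₀ with l ≥ N_p(Θ)), let δ > a₄l + 1, and let A > 0. Suppose g is a measurable function on ℝⁿ and θ_{z,t} ∈ Θ is an ellipsoid such that: (1) ((1/|θ_{z,t}|)∫_{θ_{z,t}}|g|^q)^{1/q} ≤ A|θ_{z,t}|^{−1/p}; (2) |g(x)| ≤ A|θ_{z,t}|^{−1/p}·2^{−kγδ} for all k ∈ ℕ₀ and x ∈ θ_{z,t−(k+1)γ} ∖ θ_{z,t−kγ}; (3) ∫g(x)x^α dx = 0 for all |α| ≤ l. Then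 there exist a constant C > 0 independent of g (depending only on p, q, l, δ, A and the parameters of Θ), a sequence of (p,q,l)-atoms a_j, and coefficients λ_j ∈ ℂ, such that g = Σ_j λ_j a_j with convergence in L¹(ℝⁿ) and (Σ_j |λ_j|^p)^{1/p} ≤ C. -/
open MeasureTheory Metric Set Filter ENNReal
noncomputable section

/-- `N_p(Θ)`: the least integer strictly greater than `(max(1,a₄)·n + 1)/(a₆ p)`. -/
def EllipsoidCover.Np {n : ℕ} (Θ : EllipsoidCover n) (p : ℝ) : ℤ :=
  ⌊(max 1 Θ.a₄ * n + 1) / (Θ.a₆ * p)⌋ + 1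

/-- A `(p,q,l)`-atom for the cover `Θ`: a function supported in some ellipsoid
`θ_{x,t} ∈ Θ`, with `‖a‖_{L^q} ≤ |θ_{x,t}|^{1/q − 1/p}` and vanishing moments of all
orders `≤ l`.  (Here `q ∈ [1,∞]` is an extended real; for `q = ∞` the exponent `1/q`
is read as `0`.) -/
def IsPQLAtom {n : ℕ} (Θ : EllipsoidCover n) (p : ℝ) (q : ℝ≥0∞) (l : ℕ)
    (a : Euc n → ℝ) : Prop :=
  ∃ (x : Euc n) (t : ℝ), Function.support a ⊆ Θ.θ x t ∧
    eLpNorm a q volume ≤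
      ENNReal.ofReal ((volume (Θ.θ x t)).toReal ^ (1 / q.toReal - 1 / p)) ∧
    ∀ α : Fin n → ℕ, (∑ i, α i) ≤ l → ∫ y : Euc n, a y * ∏ i, (y i) ^ (α i) = 0

/-- The span of the constants and the coordinate functions. -/
def affineFns (n : ℕ) : Submodule ℝ (Euc n → ℝ) :=
  Submodule.span ℝ (insert 1 (range fun (i : Fin n) (x : Euc n) => x i))

/-- The polynomial functions of degree at most `l`. -/
def polyFns (n l : ℕ) : Submodule ℝ (Euc n → ℝ) := affineFns n ^ l

lemma one_mem_affineFns (n : ℕ) : (1 : Euc n → ℝ) ∈ affineFns n :=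
  Submodule.subset_span (mem_insert _ _)

lemma coord_mem_affineFns {n : ℕ} (i : Fin n) : (fun x : Euc n => x i) ∈ affineFns n :=
  Submodule.subset_span (mem_insert_of_mem _ ⟨i, rfl⟩)

lemma polyFns_mono {n a b : ℕ} (h : a ≤ b) : polyFns n a ≤ polyFns n b :=
  pow_le_pow_right₀ (Submodule.one_le.mpr (one_mem_affineFns n)) h

lemma monomial_mem_polyFns {n l : ℕ} (α : Fin n → ℕ) (hα : ∑ i, α i ≤ l) :
    (fun x : Euc n => ∏ i, x i ^ α i) ∈ polyFns n l := by
  apply polyFns_mono hα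
  have h : ∀ s : Finset (Fin n),
      (fun x : Euc n => ∏ i ∈ s, x i ^ α i) ∈ polyFns n (∑ i ∈ s, α i) := by
    intro s
    induction s using Finset.induction_on with
    | empty =>
      simp only [Finset.prod_empty, Finset.sum_empty, polyFns, pow_zero]
      exact Submodule.one_le.mp le_rfl
    | insert i s hi ih =>
      simp only [Finset.prod_insert hi, Finset.sum_insert hi]
      rw [polyFns, pow_add]
      exact Submodule.mul_mem_mul (Submodule.pow_mem_pow _ (coord_mem_affineFns i) _) ih
  exact h Finset.univ

instance (n l : ℕ) : FiniteDimensional ℝ (polyFns n l) :=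
  .of_fg <| .pow (Submodule.fg_span ((finite_range _).insert _)) l

lemma affineFns_le_iff {n : ℕ} {W : Submodule ℝ (Euc n → ℝ)} :
    affineFns n ≤ W ↔ 1 ∈ W ∧ ∀ i, (fun x : Euc n => x i) ∈ W := by
  simp [affineFns, Submodule.span_le, insert_subset_iff, range_subset_iff]

lemma polyFns_analytic {n l : ℕ} {v : Euc n → ℝ} (hv : v ∈ polyFns n l) :
    AnalyticOnNhd ℝ v univ := by
  let W : Submodule ℝ (Euc n → ℝ) :=
    { carrier := {v | AnalyticOnNhd ℝ v univ}
      add_mem' := fun ha hb => ha.add hb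
      zero_mem' := analyticOnNhd_const
      smul_mem' := fun c _ h => (analyticOnNhd_const (v := c)).smul (mem_ofPred.mp h) }
  have h1 : affineFns n ≤ W := affineFns_le_iff.mpr
    ⟨analyticOnNhd_const, fun i => (EuclideanSpace.proj (𝕜 := ℝ) i).analyticOnNhd univ⟩
  induction l generalizing v with
  | zero =>
    obtain ⟨c, rfl⟩ := Submodule.mem_one.mp (by simpa [polyFns] using hv)
    exact analyticOnNhd_const
  | succ l ih =>
    rw [polyFns, pow_succ] at hv
    induction hv using Submodule.mul_induction_on' with
    | mem_mul_mem a ha b hb => exact (ih ha).mul (h1 hb)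
    | add x _ y _ hx hy => exact hx.add hy

lemma polyFns_continuous {n l : ℕ} {v : Euc n → ℝ} (hv : v ∈ polyFns n l) : Continuous v :=
  continuousOn_univ.mp (polyFns_analytic hv).continuousOn

lemma affineFns_bound {n : ℕ} {v : Euc n → ℝ} (hv : v ∈ affineFns n) :
    ∃ C, 0 ≤ C ∧ ∀ x, |v x| ≤ C * (1 + ‖x‖) := by
  induction hv using Submodule.span_induction with
  | mem x hx =>
    refine ⟨1, zero_le_one, fun y => ?_⟩
    rcases hx with rfl | ⟨i, rfl⟩
    · simp
    · have := PiLp.norm_apply_le y i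
      rw [Real.norm_eq_abs] at this
      simp only
      linarith
  | zero => exact ⟨0, le_rfl, by simp⟩
  | add x y _ _ hx hy =>
    obtain ⟨a, ha, hx⟩ := hx
    obtain ⟨b, hb, hy⟩ := hy
    refine ⟨a + b, add_nonneg ha hb, fun u => (abs_add_le _ _).trans ?_⟩
    linarith [hx u, hy u]
  | smul c x _ hx =>
    obtain ⟨a, ha, hx⟩ := hx
    refine ⟨|c| * a, by positivity, fun u => ?_⟩
    rw [Pi.smul_apply, smul_eq_mul, abs_mul, mul_assoc]
    gcongr
    exact hx u

lemma polyFns_bound {n l : ℕ} {v : Euc n → ℝ} (hv : v ∈ polyFns n l) :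
    ∃ C, 0 ≤ C ∧ ∀ x, |v x| ≤ C * (1 + ‖x‖) ^ l := by
  induction l generalizing v with
  | zero =>
    obtain ⟨c, rfl⟩ := Submodule.mem_one.mp (by simpa [polyFns] using hv)
    exact ⟨|c|, abs_nonneg _, by simp⟩
  | succ l ih =>
    rw [polyFns, pow_succ] at hv
    induction hv using Submodule.mul_induction_on' with
    | mem_mul_mem a ha b hb =>
      obtain ⟨A, hA, ha⟩ := ih ha
      obtain ⟨B, hB, hb⟩ := affineFns_bound hb
      refine ⟨A * B, mul_nonneg hA hB, fun x => ?_⟩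
      rw [Pi.mul_apply, abs_mul, pow_succ]
      calc |a x| * |b x| ≤ (A * (1 + ‖x‖) ^ l) * (B * (1 + ‖x‖)) := by
            gcongr
            exacts [ha x, hb x]
        _ = _ := by ring
    | add x _ y _ hx hy =>
      obtain ⟨a, ha, hx⟩ := hx
      obtain ⟨b, hb, hy⟩ := hy
      refine ⟨a + b, add_nonneg ha hb, fun u => (abs_add_le _ _).trans ?_⟩
      linarith [hx u, hy u]

lemma polyFns_comp_affine {n l : ℕ} {v : Euc n → ℝ} (hv : v ∈ polyFns n l)
    (T : Euc n →L[ℝ] Euc n) (z : Euc n) : (fun x => v (T x + z)) ∈ polyFns n l := by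
  let F : (Euc n → ℝ) →ₐ[ℝ] (Euc n → ℝ) :=
    { toFun := fun v x => v (T x + z)
      map_one' := rfl
      map_mul' := fun _ _ => rfl
      map_zero' := rfl
      map_add' := fun _ _ => rfl
      commutes' := fun _ => rfl }
  have h1 : (affineFns n).map F.toLinearMap ≤ affineFns n := by
    rw [Submodule.map_le_iff_le_comap, affineFns_le_iff]
    refine ⟨one_mem_affineFns n, fun i => ?_⟩
    have : (fun x : Euc n => (T x + z) i) =
        ∑ j, (T (EuclideanSpace.single j 1) i) • (fun x : Euc n => x j) + (z i) • 1 := by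
      ext x
      have hx : x = ∑ j, x j • EuclideanSpace.single j (1 : ℝ) := by
        simpa using ((EuclideanSpace.basisFun (Fin n) ℝ).sum_repr x).symm
      conv_lhs => rw [hx]
      simp [mul_comm]
    change (fun x : Euc n => (T x + z) i) ∈ affineFns n
    rw [this]
    exact add_mem (sum_mem fun j _ => Submodule.smul_mem _ _ (coord_mem_affineFns j))
      (Submodule.smul_mem _ _ (one_mem_affineFns n))
  have h2 : (polyFns n l).map F.toLinearMap ≤ polyFns n l := by
    rw [polyFns, Submodule.map_pow]
    exact pow_le_pow_left₀ zero_le h1 l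
  exact h2 ⟨v, hv, rfl⟩

lemma polyFns_integrableOn_ball {n l : ℕ} {v : Euc n → ℝ} (hv : v ∈ polyFns n l)
    {w : Euc n → ℝ} (hw : w ∈ polyFns n l) :
    IntegrableOn (fun x => v x * w x) (ball 0 1) :=
  (((polyFns_continuous hv).mul (polyFns_continuous hw)).continuousOn.integrableOn_compact
    (isCompact_closedBall (0 : Euc n) 1)).mono_set ball_subset_closedBall

/-- The `L²` pairing on the unit ball represents every functional on polynomials. -/
lemma exists_polyFns_represent {n l : ℕ} (Λ : Module.Dual ℝ (polyFns n l)) :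
    ∃ w ∈ polyFns n l, ∀ v : polyFns n l,
      ∫ x in ball (0 : Euc n) 1, w x * (v : Euc n → ℝ) x = Λ v := by
  let B : polyFns n l →ₗ[ℝ] Module.Dual ℝ (polyFns n l) :=
    LinearMap.mk₂ ℝ (fun w v => ∫ x in ball (0 : Euc n) 1, (w : Euc n → ℝ) x * (v : Euc n → ℝ) x)
      (fun a b c => by
        simp only [Submodule.coe_add, Pi.add_apply, add_mul]
        exact integral_add (polyFns_integrableOn_ball a.2 c.2) (polyFns_integrableOn_ball b.2 c.2))
      (fun r a c => by
        simp only [Submodule.coe_smul, Pi.smul_apply, smul_eq_mul, mul_assoc]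
        exact integral_const_mul _ _)
      (fun a b c => by
        simp only [Submodule.coe_add, Pi.add_apply, mul_add]
        exact integral_add (polyFns_integrableOn_ball a.2 b.2) (polyFns_integrableOn_ball a.2 c.2))
      (fun r a c => by
        simp only [Submodule.coe_smul, Pi.smul_apply, smul_eq_mul, mul_left_comm]
        exact integral_const_mul _ _)
  have hB : Function.Injective B := by
    rw [← LinearMap.ker_eq_bot, LinearMap.ker_eq_bot']
    intro w hw
    have h0 : ∫ x in ball (0 : Euc n) 1, (w : Euc n → ℝ) x * (w : Euc n → ℝ) x = 0 :=
      congrArg (fun L => L w) hw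
    rw [setIntegral_eq_zero_iff_of_nonneg_ae
      (Eventually.of_forall fun x => mul_self_nonneg _) (polyFns_integrableOn_ball w.2 w.2)] at h0
    have hc := polyFns_continuous w.2
    have h1 : EqOn (fun x => (w : Euc n → ℝ) x * (w : Euc n → ℝ) x) 0 (ball 0 1) :=
      Measure.eqOn_open_of_ae_eq h0 isOpen_ball (hc.mul hc).continuousOn continuousOn_const
    have h2 : (w : Euc n → ℝ) =ᶠ[nhds 0] 0 := by
      filter_upwards [isOpen_ball.mem_nhds (mem_ball_self (x := (0 : Euc n)) one_pos)] with x hx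
      simpa using h1 hx
    have h3 := (polyFns_analytic w.2).eq_of_eventuallyEq
      (analyticOnNhd_const (v := (0 : ℝ))) h2
    exact Subtype.ext h3
  obtain ⟨w, hw⟩ := (LinearMap.injective_iff_surjective_of_finrank_eq_finrank
    (Subspace.dual_finrank_eq (K := ℝ) (V := polyFns n l)).symm).mp hB Λ
  exact ⟨w, w.2, fun v => congrArg (fun L => L v) hw⟩

lemma integrable_mul_polyFns {n l : ℕ} {v : Euc n → ℝ} (hv : v ∈ polyFns n l)
    (T : Euc n ≃L[ℝ] Euc n) (z : Euc n) {f : Euc n → ℝ} (hf : Measurable f)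
    (hi : Integrable fun x => |f x| * (1 + ‖T.symm (x - z)‖) ^ l) :
    Integrable fun x => f x * v x := by
  obtain ⟨C, -, hC⟩ := polyFns_bound (polyFns_comp_affine hv T z)
  refine (hi.const_mul C).mono'
    (hf.mul (polyFns_continuous hv).measurable).aestronglyMeasurable (ae_of_all _ fun x => ?_)
  have := hC (T.symm (x - z))
  simp only [ContinuousLinearEquiv.coe_coe, ContinuousLinearEquiv.apply_symm_apply,
    sub_add_cancel] at this
  rw [Real.norm_eq_abs, abs_mul]
  calc |f x| * |v x| ≤ |f x| * (C * (1 + ‖T.symm (x - z)‖) ^ l) := by gcongr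
    _ = _ := by ring

lemma integrable_mul_polyFns_of_support {n l : ℕ} {v : Euc n → ℝ} (hv : v ∈ polyFns n l)
    (T : Euc n ≃L[ℝ] Euc n) (z : Euc n) {f : Euc n → ℝ} (hf : Measurable f)
    (hi : Integrable f) (hs : ∀ x ∉ (fun y => T y + z) '' ball 0 1, f x = 0) :
    Integrable fun x => f x * v x := by
  have hw : Continuous fun x => (1 + ‖T.symm (x - z)‖) ^ l :=
    (continuous_const.add (T.symm.continuous.comp
      (continuous_id.sub continuous_const)).norm).pow l
  refine integrable_mul_polyFns hv T z hf ((hi.norm.mul_const (2 ^ l)).mono'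
    ((measurable_norm.comp hf).mul hw.measurable).aestronglyMeasurable (ae_of_all _ fun x => ?_))
  rw [Real.norm_of_nonneg (by positivity), Real.norm_eq_abs]
  by_cases hx : x ∈ (fun y => T y + z) '' ball 0 1
  · gcongr
    obtain ⟨y, hy, rfl⟩ := hx
    have : ‖y‖ < 1 := by simpa using hy
    simp only [add_sub_cancel_right, ContinuousLinearEquiv.symm_apply_apply]
    linarith
  · simp only [hs x hx, abs_zero, zero_mul, le_refl]

/-- A bounded function supported in the unit ball with the same moments as `f`. -/
lemma exists_moment_match_unit (n l : ℕ) : ∃ K : ℝ, 0 ≤ K ∧ ∀ f : Euc n → ℝ, Measurable f →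
    Integrable (fun x => |f x| * (1 + ‖x‖) ^ l) →
    ∃ φ : Euc n → ℝ, Measurable φ ∧ (∀ x ∉ ball (0 : Euc n) 1, φ x = 0) ∧
      (∀ x, |φ x| ≤ K * ∫ y, |f y| * (1 + ‖y‖) ^ l) ∧
      ∀ v ∈ polyFns n l, ∫ x, φ x * v x = ∫ x, f x * v x := by
  let b := Module.finBasis ℝ (polyFns n l)
  choose w hw hrep using fun i => exists_polyFns_represent (b.coord i)
  choose C hC0 hC using fun i => polyFns_bound (hw i)
  choose D hD0 hD using fun i => polyFns_bound (b i).2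
  refine ⟨∑ i, D i * (C i * 2 ^ l), Finset.sum_nonneg fun i _ =>
    mul_nonneg (hD0 i) (mul_nonneg (hC0 i) (by positivity)), fun f hf hi => ?_⟩
  have hint : ∀ v ∈ polyFns n l, Integrable fun x => f x * v x := fun v hv =>
    integrable_mul_polyFns hv (.refl ℝ _) 0 hf (by simpa using hi)
  let I := ∫ y, |f y| * (1 + ‖y‖) ^ l
  have hI : 0 ≤ I := integral_nonneg fun x => by positivity
  let m : Fin (Module.finrank ℝ (polyFns n l)) → ℝ := fun i => ∫ x, f x * (b i : Euc n → ℝ) x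
  have hm : ∀ i, |m i| ≤ D i * I := fun i => by
    rw [← Real.norm_eq_abs, ← integral_const_mul]
    refine norm_integral_le_of_norm_le (hi.const_mul _) (ae_of_all _ fun x => ?_)
    rw [Real.norm_eq_abs, abs_mul]
    calc |f x| * |(b i : Euc n → ℝ) x| ≤ |f x| * (D i * (1 + ‖x‖) ^ l) := by
          gcongr
          exact hD i x
      _ = _ := by ring
  refine ⟨(ball 0 1).indicator fun x => ∑ i, m i * w i x, ?_, fun x hx => indicator_of_notMem hx _,
    fun x => ?_, fun v hv => ?_⟩
  · exact (Finset.measurable_sum _ fun i _ =>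
      (polyFns_continuous (hw i)).measurable.const_mul _).indicator measurableSet_ball
  · by_cases hx : x ∈ ball (0 : Euc n) 1
    · rw [indicator_of_mem hx, Finset.sum_mul]
      refine (Finset.abs_sum_le_sum_abs _ _).trans (Finset.sum_le_sum fun i _ => ?_)
      have h2 : |w i x| ≤ C i * 2 ^ l := by
        refine (hC i x).trans ?_
        have : ‖x‖ < 1 := by simpa using hx
        gcongr
        · exact hC0 i
        · linarith
      rw [abs_mul]
      calc |m i| * |w i x| ≤ (D i * I) * (C i * 2 ^ l) :=
            mul_le_mul (hm i) h2 (abs_nonneg _) (mul_nonneg (hD0 i) hI)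
        _ = _ := by ring
    · rw [indicator_of_notMem hx, abs_zero]
      exact mul_nonneg (Finset.sum_nonneg fun i _ =>
        mul_nonneg (hD0 i) (mul_nonneg (hC0 i) (by positivity))) hI
  · let c := b.repr ⟨v, hv⟩
    have hvs : v = fun x => ∑ i, c i * (b i : Euc n → ℝ) x := by
      have h : v = ((∑ i, c i • b i : polyFns n l) : Euc n → ℝ) := by rw [b.sum_repr]
      ext x
      conv_lhs => rw [h]
      simp
    have h1 : ∀ i, ∫ x in ball (0 : Euc n) 1, w i x * v x = c i := fun i => hrep i ⟨v, hv⟩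
    calc ∫ x, (ball 0 1).indicator (fun x => ∑ i, m i * w i x) x * v x
        = ∫ x in ball (0 : Euc n) 1, ∑ i, m i * (w i x * v x) := by
          rw [← integral_indicator measurableSet_ball]
          congr 1
          ext x
          by_cases hx : x ∈ ball (0 : Euc n) 1
          · simp only [indicator_of_mem hx, Finset.sum_mul, mul_assoc]
          · simp only [indicator_of_notMem hx, zero_mul]
      _ = ∑ i, m i * c i := by
          rw [integral_finsetSum _ fun i _ =>
            (polyFns_integrableOn_ball (hw i) hv).const_mul _]
          simp only [integral_const_mul, h1]
      _ = ∫ x, ∑ i, c i * (f x * (b i : Euc n → ℝ) x) := by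
          rw [integral_finsetSum _ fun i _ => (hint _ (b i).2).const_mul _]
          exact Finset.sum_congr rfl fun i _ => by rw [integral_const_mul, mul_comm]
      _ = ∫ x, f x * v x := by
          congr 1
          ext x
          conv_rhs => rw [hvs]
          simp only [Finset.mul_sum, mul_left_comm]

lemma map_affine_volume {n : ℕ} (T : Euc n ≃L[ℝ] Euc n) (z : Euc n) :
    Measure.map (fun x => T x + z) (volume : Measure (Euc n)) =
      ENNReal.ofReal |(LinearMap.det (T : Euc n →ₗ[ℝ] Euc n))⁻¹| • volume := by
  have h := Measure.map_linearMap_addHaar_eq_smul_addHaar (volume : Measure (Euc n))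
    (f := (T : Euc n →ₗ[ℝ] Euc n)) (LinearEquiv.isUnit_det' T.toLinearEquiv).ne_zero
  have hT : Measurable fun x => T x := T.continuous.measurable
  rw [show (fun x => T x + z) = (fun x => x + z) ∘ (fun x => T x) from rfl,
    ← Measure.map_map (measurable_add_const z) hT]
  change Measure.map (fun x => T x) volume = _ at h
  rw [h, Measure.map_smul, map_add_right_eq_self]

lemma volume_affine_ball {n : ℕ} (T : Euc n ≃L[ℝ] Euc n) (z : Euc n) :
    (volume ((fun x => T x + z) '' ball 0 1)).toReal =
      |LinearMap.det (T : Euc n →ₗ[ℝ] Euc n)| * (volume (ball (0 : Euc n) 1)).toReal := by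
  rw [show (fun x => T x + z) = (fun x => x + z) ∘ (fun x => T x) from rfl, image_comp,
    image_add_right, measure_preimage_add_right]
  have := Measure.addHaar_image_continuousLinearEquiv (volume : Measure (Euc n)) T (ball 0 1)
  rw [this, ENNReal.toReal_mul, ENNReal.toReal_ofReal (abs_nonneg _)]

/-- A bounded function supported in an ellipsoid with the same moments as `f`. -/
lemma exists_moment_match (n l : ℕ) : ∃ K : ℝ, 0 ≤ K ∧
    ∀ (T : Euc n ≃L[ℝ] Euc n) (z : Euc n) (f : Euc n → ℝ), Measurable f →
    Integrable (fun x => |f x| * (1 + ‖T.symm (x - z)‖) ^ l) →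
    ∃ φ : Euc n → ℝ, Measurable φ ∧ (∀ x ∉ (fun y => T y + z) '' ball 0 1, φ x = 0) ∧
      (∀ x, |φ x| ≤ K / (volume ((fun y => T y + z) '' ball 0 1)).toReal *
        ∫ y, |f y| * (1 + ‖T.symm (y - z)‖) ^ l) ∧
      ∀ v ∈ polyFns n l, ∫ x, φ x * v x = ∫ x, f x * v x := by
  obtain ⟨K, hK, H⟩ := exists_moment_match_unit n l
  refine ⟨K * (volume (ball (0 : Euc n) 1)).toReal, by positivity, fun T z f hf hi => ?_⟩
  set d := |LinearMap.det (T : Euc n →ₗ[ℝ] Euc n)| with hd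
  have hd0 : 0 < d := abs_pos.mpr (LinearEquiv.isUnit_det' T.toLinearEquiv).ne_zero
  have hB0 : 0 < (volume (ball (0 : Euc n) 1)).toReal :=
    ENNReal.toReal_pos (measure_ball_pos _ _ one_pos).ne' measure_ball_lt_top.ne
  have hmap := map_affine_volume T z
  rw [abs_inv, ← hd] at hmap
  have hemb : MeasurableEmbedding fun x => T x + z :=
    (T.toHomeomorph.trans (Homeomorph.addRight z)).measurableEmbedding
  have hcomp : ∀ F : Euc n → ℝ, ∫ x, F (T x + z) = d⁻¹ * ∫ x, F x := fun F => by
    rw [← hemb.integral_map, hmap, integral_smul_measure,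
      ENNReal.toReal_ofReal (inv_nonneg.mpr hd0.le), smul_eq_mul]
  have hi' : Integrable fun x => |f (T x + z)| * (1 + ‖x‖) ^ l := by
    have : Integrable (fun x => |f x| * (1 + ‖T.symm (x - z)‖) ^ l)
        (Measure.map (fun x => T x + z) volume) := by
      rw [hmap]
      exact hi.smul_measure ENNReal.ofReal_ne_top
    rw [hemb.integrable_map_iff] at this
    simpa [Function.comp_def] using this
  obtain ⟨ψ, hψm, hψ0, hψb, hψv⟩ := H (fun x => f (T x + z)) (hf.comp hemb.measurable) hi'
  have hinv : ∀ x, T (T.symm (x - z)) + z = x := fun x => by simp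
  refine ⟨fun x => ψ (T.symm (x - z)), ?_, fun x hx => hψ0 _ fun hx' => hx ⟨_, hx', hinv x⟩,
    fun x => ?_, fun v hv => ?_⟩
  · exact hψm.comp (T.symm.continuous.measurable.comp (measurable_sub_const z))
  · refine (hψb _).trans_eq ?_
    have := hcomp fun x => |f x| * (1 + ‖T.symm (x - z)‖) ^ l
    simp only [add_sub_cancel_right, ContinuousLinearEquiv.symm_apply_apply] at this
    rw [this, volume_affine_ball, ← hd]
    field_simp
  · have h1 := hcomp fun x => ψ (T.symm (x - z)) * v x
    have h2 := hcomp fun x => f x * v x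
    simp only [add_sub_cancel_right, ContinuousLinearEquiv.symm_apply_apply] at h1
    have h3 := hψv _ (polyFns_comp_affine hv T z)
    simp only [ContinuousLinearEquiv.coe_coe] at h3
    rw [h1, h2] at h3
    exact mul_left_cancel₀ (inv_ne_zero hd0.ne') h3

lemma tendsto_two_rpow_neg {c : ℝ} (hc : 0 < c) :
    Tendsto (fun u : ℝ => (2 : ℝ) ^ (-(c * u))) atTop (nhds 0) := by
  have h := (tendsto_id.const_mul_atTop hc)
  exact (tendsto_rpow_atBot_of_base_gt_one 2 one_lt_two).comp (tendsto_neg_atTop_atBot.comp h)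

namespace EllipsoidCover

variable {n : ℕ} (Θ : EllipsoidCover n)

lemma measurableSet_θ (x : Euc n) (t : ℝ) : MeasurableSet (Θ.θ x t) :=
  (((Θ.M x t).toHomeomorph.trans (Homeomorph.addRight x)).isOpenMap _ isOpen_ball).measurableSet

lemma mem_θ_self (x : Euc n) (t : ℝ) : x ∈ Θ.θ x t :=
  ⟨0, mem_ball_self one_pos, by simp⟩

lemma le_volume_θ (x : Euc n) (t : ℝ) : Θ.a₁ * 2 ^ (-t) ≤ (volume (Θ.θ x t)).toReal :=
  Θ.volume_lb x t

lemma volume_θ_le (x : Euc n) (t : ℝ) : (volume (Θ.θ x t)).toReal ≤ Θ.a₂ * 2 ^ (-t) :=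
  Θ.volume_ub x t

lemma volume_θ_pos (x : Euc n) (t : ℝ) : 0 < (volume (Θ.θ x t)).toReal :=
  (mul_pos Θ.ha₁ (by positivity)).trans_le (Θ.le_volume_θ x t)

lemma volume_θ_ne_top (x : Euc n) (t : ℝ) : volume (Θ.θ x t) ≠ ∞ :=
  (ENNReal.toReal_pos_iff.mp (Θ.volume_θ_pos x t)).2.ne

/-- Comparison of the volumes of two ellipsoids with different scales. -/
lemma volume_θ_sub_le (x y : Euc n) (t u : ℝ) : (volume (Θ.θ y (t - u))).toReal ≤
    Θ.a₂ / Θ.a₁ * (volume (Θ.θ x t)).toReal * 2 ^ u := by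
  have h1 := Θ.le_volume_θ x t
  have h2 := Θ.volume_θ_le y (t - u)
  have := Θ.ha₁
  have := Θ.ha₂
  rw [show -(t - u) = -t + u by ring, Real.rpow_add two_pos] at h2
  calc (volume (Θ.θ y (t - u))).toReal ≤ Θ.a₂ / Θ.a₁ * (Θ.a₁ * 2 ^ (-t)) * 2 ^ u := by
        refine h2.trans_eq ?_
        field_simp
    _ ≤ _ := by gcongr

lemma le_volume_θ_sub (x y : Euc n) (t u : ℝ) :
    Θ.a₁ / Θ.a₂ * (volume (Θ.θ x t)).toReal * 2 ^ u ≤ (volume (Θ.θ y (t - u))).toReal := by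
  have h1 := Θ.volume_θ_le x t
  have h2 := Θ.le_volume_θ y (t - u)
  have := Θ.ha₁
  have := Θ.ha₂
  rw [show -(t - u) = -t + u by ring, Real.rpow_add two_pos] at h2
  calc Θ.a₁ / Θ.a₂ * (volume (Θ.θ x t)).toReal * 2 ^ u
      ≤ Θ.a₁ / Θ.a₂ * (Θ.a₂ * 2 ^ (-t)) * 2 ^ u := by gcongr
    _ ≤ _ := by
        refine le_trans (le_of_eq ?_) h2
        field_simp

lemma shape_center (z : Euc n) (t u : ℝ) (hu : 0 ≤ u) :
    Θ.a₃ * 2 ^ (-(Θ.a₄ * u)) ≤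
        1 / ‖((Θ.M z t).symm : Euc n →L[ℝ] Euc n).comp (Θ.M z (t - u) : Euc n →L[ℝ] Euc n)‖ ∧
    1 / ‖((Θ.M z t).symm : Euc n →L[ℝ] Euc n).comp (Θ.M z (t - u) : Euc n →L[ℝ] Euc n)‖ ≤
        ‖((Θ.M z (t - u)).symm : Euc n →L[ℝ] Euc n).comp (Θ.M z t : Euc n →L[ℝ] Euc n)‖ ∧
    ‖((Θ.M z (t - u)).symm : Euc n →L[ℝ] Euc n).comp (Θ.M z t : Euc n →L[ℝ] Euc n)‖ ≤
        Θ.a₅ * 2 ^ (-(Θ.a₆ * u)) := by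
  have := Θ.shape z z (t - u) u hu ⟨z, Θ.mem_θ_self z _, Θ.mem_θ_self z _⟩
  rwa [sub_add_cancel] at this

lemma norm_symm_le {z x : Euc n} {t u : ℝ} (hu : 0 ≤ u) (hx : x ∈ Θ.θ z (t - u)) :
    ‖(Θ.M z t).symm (x - z)‖ ≤ 2 ^ (Θ.a₄ * u) / Θ.a₃ := by
  obtain ⟨y, hy, rfl⟩ := hx
  have hy1 : ‖y‖ < 1 := by simpa using hy
  have h := (Θ.shape_center z t u hu).1
  set S := ((Θ.M z t).symm : Euc n →L[ℝ] Euc n).comp (Θ.M z (t - u) : Euc n →L[ℝ] Euc n)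
  have h3 := Θ.ha₃
  have hpos : 0 < 1 / ‖S‖ := lt_of_lt_of_le (by positivity) h
  have hS : ‖S‖ ≤ 2 ^ (Θ.a₄ * u) / Θ.a₃ := by
    have := one_div_le_one_div_of_le (by positivity) h
    rw [one_div_one_div, Real.rpow_neg two_pos.le] at this
    refine this.trans_eq ?_
    field_simp
  simp only [add_sub_cancel_right]
  calc ‖S y‖ ≤ ‖S‖ * ‖y‖ := S.le_opNorm y
    _ ≤ ‖S‖ * 1 := by gcongr
    _ ≤ _ := by rwa [mul_one]

lemma a₆_le_a₄ : Θ.a₆ ≤ Θ.a₄ := by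
  by_contra! h
  have h1 := (tendsto_two_rpow_neg (sub_pos.mpr h)).const_mul Θ.a₅
  rw [mul_zero] at h1
  obtain ⟨u, hu, hu0⟩ := ((h1.eventually (gt_mem_nhds Θ.ha₃)).and (eventually_ge_atTop 0)).exists
  obtain ⟨s1, s2, s3⟩ := Θ.shape_center 0 0 u hu0
  have h2 := s1.trans (s2.trans s3)
  rw [show -(Θ.a₆ * u) = -((Θ.a₆ - Θ.a₄) * u) + -(Θ.a₄ * u) by ring, Real.rpow_add two_pos,
    ← mul_assoc] at h2
  exact hu.not_ge (le_of_mul_le_mul_right h2 (by positivity))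

lemma exists_mem_θ_sub {γ : ℝ} (hγ : 0 < γ) (z : Euc n) (t : ℝ) (x : Euc n) :
    ∃ k : ℕ, x ∈ Θ.θ z (t - k * γ) := by
  have hT : Tendsto (fun k : ℕ => (k : ℝ) * γ) atTop atTop :=
    tendsto_natCast_atTop_atTop.atTop_mul_const hγ
  have h1 := (((tendsto_two_rpow_neg Θ.ha₆).comp hT).const_mul Θ.a₅).mul_const
    ‖(Θ.M z t).symm (x - z)‖
  rw [mul_zero, zero_mul] at h1
  obtain ⟨k, hk⟩ := (h1.eventually (gt_mem_nhds zero_lt_one)).exists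
  refine ⟨k, (Θ.M z (t - k * γ)).symm (x - z), ?_, by simp⟩
  have h2 := (Θ.shape_center z t (k * γ) (by positivity)).2.2
  have h3 := (((Θ.M z (t - k * γ)).symm : Euc n →L[ℝ] Euc n).comp
    (Θ.M z t : Euc n →L[ℝ] Euc n)).le_opNorm ((Θ.M z t).symm (x - z))
  simp only [ContinuousLinearMap.coe_comp, Function.comp_apply, ContinuousLinearEquiv.coe_coe,
    ContinuousLinearEquiv.apply_symm_apply] at h3
  rw [mem_ball_zero_iff]
  refine lt_of_le_of_lt (h3.trans ?_) hk
  exact mul_le_mul_of_nonneg_right h2 (norm_nonneg _)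

variable {Θ} {γ : ℝ}

lemma θ_sub_mono (hincl : ∀ (x y : Euc n) (t s : ℝ), t ≤ s → (Θ.θ x t ∩ Θ.θ y s).Nonempty →
    Θ.θ y s ⊆ Θ.θ x (t - γ)) (z : Euc n) (t : ℝ) :
    Monotone fun k : ℕ => Θ.θ z (t - k * γ) := by
  refine monotone_nat_of_le_succ fun k => ?_
  have := hincl z z (t - k * γ) (t - k * γ) le_rfl ⟨z, Θ.mem_θ_self z _, Θ.mem_θ_self z _⟩
  rwa [show t - k * γ - γ = t - (k + 1 : ℕ) * γ by push_cast; ring] at this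

lemma compl_θ_subset (hγ : 0 < γ) (z : Euc n) (t : ℝ) (k : ℕ) : (Θ.θ z (t - k * γ))ᶜ ⊆
    ⋃ i : ℕ, Θ.θ z (t - ((k + i : ℕ) + 1) * γ) \ Θ.θ z (t - (k + i : ℕ) * γ) := by
  intro x hx
  by_contra! h
  simp only [mem_iUnion, not_exists, Set.mem_sdiff, not_and, not_not] at h
  obtain ⟨j, hj⟩ := Θ.exists_mem_θ_sub hγ z (t - k * γ) x
  have : ∀ i : ℕ, x ∉ Θ.θ z (t - (k + i : ℕ) * γ) := by
    intro i
    induction i with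
    | zero => simpa using hx
    | succ i ih =>
      intro hi
      refine ih (h i ?_)
      convert hi using 2
      push_cast
      ring
  refine this j ?_
  convert hj using 2
  push_cast
  ring

/-- The weighted mass of a molecule outside a dilated ellipsoid. -/
lemma exists_lintegral_tail_le (Θ : EllipsoidCover n) (hγ : 0 < γ) (l : ℕ) {δ : ℝ}
    (hδ : Θ.a₄ * l + 1 < δ) :
    ∃ C : ℝ, 0 ≤ C ∧ ∀ (g : Euc n → ℝ) (z : Euc n) (t b : ℝ), 0 ≤ b →
      (∀ k : ℕ, ∀ x ∈ Θ.θ z (t - ((k : ℝ) + 1) * γ) \ Θ.θ z (t - (k : ℝ) * γ),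
        |g x| ≤ b * 2 ^ (-((k : ℝ) * γ * δ))) →
      ∀ k : ℕ, ∫⁻ x in (Θ.θ z (t - k * γ))ᶜ,
          ENNReal.ofReal (|g x| * (1 + ‖(Θ.M z (t - k * γ)).symm (x - z)‖) ^ l) ≤
        ENNReal.ofReal (C * (b * (volume (Θ.θ z t)).toReal * 2 ^ (-((k : ℝ) * γ * (δ - 1))))) := by
  have h1 := Θ.ha₁
  have h2 := Θ.ha₂
  have h3 := Θ.ha₃
  have h4 := Θ.ha₄
  set D : ℝ := 1 + 1 / Θ.a₃
  have hD : 0 < D := by positivity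
  set r : ℝ := 2 ^ (-(γ * (δ - 1 - Θ.a₄ * l)))
  have hr0 : 0 ≤ r := by positivity
  have hr1 : r < 1 := Real.rpow_lt_one_of_one_lt_of_neg one_lt_two
    (neg_lt_zero.mpr (mul_pos hγ (by linarith)))
  set C : ℝ := D ^ l * 2 ^ (Θ.a₄ * γ * l) * (Θ.a₂ / Θ.a₁) * 2 ^ γ
  refine ⟨C * (1 - r)⁻¹, mul_nonneg (by positivity) (inv_nonneg.mpr (by linarith)),
    fun g z t b hb hg k => ?_⟩
  set v := (volume (Θ.θ z t)).toReal
  have hv : 0 ≤ v := ENNReal.toReal_nonneg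
  set N : ℝ := C * (b * v * 2 ^ (-((k : ℝ) * γ * (δ - 1)))) with hN
  have hN0 : 0 ≤ N := by positivity
  calc _ ≤ ∑' i : ℕ, ∫⁻ x in Θ.θ z (t - ((k + i : ℕ) + 1) * γ) \ Θ.θ z (t - (k + i : ℕ) * γ),
          ENNReal.ofReal (|g x| * (1 + ‖(Θ.M z (t - k * γ)).symm (x - z)‖) ^ l) :=
        (lintegral_mono_set (compl_θ_subset hγ z t k)).trans (lintegral_iUnion_le _ _)
    _ ≤ ∑' i : ℕ, ENNReal.ofReal (N * r ^ i) := by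
        refine ENNReal.tsum_le_tsum fun i => ?_
        set j := k + i with hj
        set B : ℝ := b * 2 ^ (-((j : ℝ) * γ * δ)) * (D * 2 ^ (Θ.a₄ * ((i + 1) * γ))) ^ l
        have hB : 0 ≤ B := by positivity
        have hpt : ∀ x ∈ Θ.θ z (t - ((j : ℝ) + 1) * γ) \ Θ.θ z (t - (j : ℝ) * γ),
            |g x| * (1 + ‖(Θ.M z (t - k * γ)).symm (x - z)‖) ^ l ≤ B := by
          intro x hx
          have hu : 0 ≤ ((i : ℝ) + 1) * γ := by positivity
          have hx1 : x ∈ Θ.θ z (t - k * γ - (i + 1) * γ) := by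
            convert hx.1 using 2
            rw [hj]
            push_cast
            ring
          have hw := Θ.norm_symm_le hu hx1
          have h1le : (1 : ℝ) ≤ 2 ^ (Θ.a₄ * ((i + 1) * γ)) :=
            Real.one_le_rpow one_le_two (by positivity)
          have hw' : 1 + ‖(Θ.M z (t - k * γ)).symm (x - z)‖ ≤
              D * 2 ^ (Θ.a₄ * ((i + 1) * γ)) := by
            calc _ ≤ 2 ^ (Θ.a₄ * ((i + 1) * γ)) + 2 ^ (Θ.a₄ * ((i + 1) * γ)) / Θ.a₃ :=
                  add_le_add h1le hw
              _ = _ := by ring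
          exact mul_le_mul (hg j x hx) (pow_le_pow_left₀ (by positivity) hw' l)
            (by positivity) (by positivity)
        have hvol : volume (Θ.θ z (t - ((j : ℝ) + 1) * γ) \ Θ.θ z (t - (j : ℝ) * γ)) ≤
            ENNReal.ofReal (Θ.a₂ / Θ.a₁ * v * 2 ^ (((j : ℝ) + 1) * γ)) := by
          refine (measure_mono sdiff_subset).trans ?_
          rw [← ENNReal.ofReal_toReal (Θ.volume_θ_ne_top z _)]
          exact ENNReal.ofReal_le_ofReal (Θ.volume_θ_sub_le z z t _)
        calc _ ≤ ∫⁻ x in Θ.θ z (t - ((j : ℝ) + 1) * γ) \ Θ.θ z (t - (j : ℝ) * γ),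
                ENNReal.ofReal B :=
              setLIntegral_mono' ((Θ.measurableSet_θ _ _).diff (Θ.measurableSet_θ _ _))
                fun x hx => ENNReal.ofReal_le_ofReal (hpt x hx)
          _ ≤ ENNReal.ofReal B * ENNReal.ofReal (Θ.a₂ / Θ.a₁ * v * 2 ^ (((j : ℝ) + 1) * γ)) := by
              rw [setLIntegral_const]
              gcongr
          _ = ENNReal.ofReal (N * r ^ i) := by
              rw [← ENNReal.ofReal_mul hB]
              congr 1
              have key : (2 : ℝ) ^ (-((j : ℝ) * γ * δ)) * (2 ^ (Θ.a₄ * ((i + 1) * γ))) ^ l *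
                  2 ^ (((j : ℝ) + 1) * γ) = 2 ^ (Θ.a₄ * γ * l) * 2 ^ γ *
                  2 ^ (-((k : ℝ) * γ * (δ - 1))) * r ^ i := by
                simp only [r, ← Real.rpow_mul_natCast two_pos.le, ← Real.rpow_add two_pos]
                congr 1
                rw [hj]
                push_cast
                ring
              simp only [B, hN, C, mul_pow]
              linear_combination (b * D ^ l * (Θ.a₂ / Θ.a₁) * v) * key
    _ = ENNReal.ofReal (C * (1 - r)⁻¹ * (b * v * 2 ^ (-((k : ℝ) * γ * (δ - 1))))) := by
        rw [← ENNReal.ofReal_tsum_of_nonneg (fun i => by positivity)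
          ((summable_geometric_of_lt_one hr0 hr1).mul_left N), tsum_mul_left,
          tsum_geometric_of_lt_one hr0 hr1]
        congr 1
        rw [hN]
        ring

/-- Truncating a molecule to dilated ellipsoids, with bounded corrections of the moments. -/
lemma exists_truncation (Θ : EllipsoidCover n) (hγ : 0 < γ) (l : ℕ) {δ : ℝ}
    (hδ : Θ.a₄ * l + 1 < δ) :
    ∃ C : ℝ, 0 ≤ C ∧ ∀ (g : Euc n → ℝ) (z : Euc n) (t b : ℝ), 0 ≤ b → Measurable g →
      IntegrableOn g (Θ.θ z t) →
      (∀ k : ℕ, ∀ x ∈ Θ.θ z (t - ((k : ℝ) + 1) * γ) \ Θ.θ z (t - (k : ℝ) * γ),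
        |g x| ≤ b * 2 ^ (-((k : ℝ) * γ * δ))) →
      (∀ α : Fin n → ℕ, (∑ i, α i) ≤ l → ∫ x : Euc n, g x * ∏ i, (x i) ^ (α i) = 0) →
      (∀ k : ℕ, ∫⁻ x in (Θ.θ z (t - k * γ))ᶜ, ENNReal.ofReal |g x| ≤
        ENNReal.ofReal (C * (b * (volume (Θ.θ z t)).toReal * 2 ^ (-((k : ℝ) * γ * (δ - 1)))))) ∧
      ∃ φ : ℕ → Euc n → ℝ, (∀ k, Measurable (φ k)) ∧
        (∀ k : ℕ, ∀ x ∉ Θ.θ z (t - k * γ), φ k x = 0) ∧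
        (∀ (k : ℕ) (x), |φ k x| ≤ C * (b * 2 ^ (-((k : ℝ) * γ * δ)))) ∧
        ∀ (k : ℕ) (α : Fin n → ℕ), (∑ i, α i) ≤ l →
          Integrable (fun x : Euc n =>
            ((Θ.θ z (t - k * γ)).indicator g x + φ k x) * ∏ i, (x i) ^ (α i)) ∧
          ∫ x : Euc n,
            ((Θ.θ z (t - k * γ)).indicator g x + φ k x) * ∏ i, (x i) ^ (α i) = 0 := by
  obtain ⟨C, hC, htail⟩ := exists_lintegral_tail_le Θ hγ l hδ
  obtain ⟨K, hK, hmatch⟩ := exists_moment_match n l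
  have h1 := Θ.ha₁
  have h2 := Θ.ha₂
  refine ⟨C + K * C * (Θ.a₂ / Θ.a₁), by positivity, fun g z t b hb hgm hgi hg hmom => ?_⟩
  specialize htail g z t b hb hg
  set v := (volume (Θ.θ z t)).toReal with hv
  have hv0 : 0 < v := Θ.volume_θ_pos z t
  have hE : ∀ k : ℕ, MeasurableSet (Θ.θ z (t - k * γ)) := fun k => Θ.measurableSet_θ _ _
  refine ⟨fun k => ?_, ?_⟩
  · refine le_trans (lintegral_mono fun x => ENNReal.ofReal_le_ofReal ?_) ((htail k).trans
      (ENNReal.ofReal_le_ofReal ?_))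
    · exact le_mul_of_one_le_right (abs_nonneg _)
        (one_le_pow₀ (le_add_of_nonneg_right (norm_nonneg _)))
    · gcongr
      exact le_add_of_nonneg_right (by positivity)
  have hw : ∀ k : ℕ, Continuous fun x => (1 + ‖(Θ.M z (t - k * γ)).symm (x - z)‖) ^ l := fun k =>
    (continuous_const.add ((Θ.M z (t - k * γ)).symm.continuous.comp
      (continuous_id.sub continuous_const)).norm).pow l
  let f : ℕ → Euc n → ℝ := fun k => (Θ.θ z (t - k * γ))ᶜ.indicator g
  have hfm : ∀ k, Measurable (f k) := fun k => hgm.indicator (hE k).compl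
  have hlint : ∀ k, ∫⁻ x, ENNReal.ofReal
      (|f k x| * (1 + ‖(Θ.M z (t - k * γ)).symm (x - z)‖) ^ l) ≤
      ENNReal.ofReal (C * (b * v * 2 ^ (-((k : ℝ) * γ * (δ - 1))))) := fun k => by
    refine le_of_eq_of_le ?_ (htail k)
    rw [← lintegral_indicator (hE k).compl]
    congr 1
    ext x
    by_cases hx : x ∈ (Θ.θ z (t - k * γ))ᶜ
    · simp only [f, indicator_of_mem hx]
    · simp only [f, indicator_of_notMem hx, abs_zero, zero_mul, ENNReal.ofReal_zero]
  have hnn : ∀ (k : ℕ) (x : Euc n),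
      0 ≤ |f k x| * (1 + ‖(Θ.M z (t - k * γ)).symm (x - z)‖) ^ l := fun k x => by positivity
  have hmeas : ∀ k : ℕ, AEStronglyMeasurable
      (fun x => |f k x| * (1 + ‖(Θ.M z (t - k * γ)).symm (x - z)‖) ^ l) volume := fun k =>
    ((measurable_norm.comp (hfm k)).mul (hw k).measurable).aestronglyMeasurable
  have hfi : ∀ k : ℕ, Integrable fun x =>
      |f k x| * (1 + ‖(Θ.M z (t - k * γ)).symm (x - z)‖) ^ l := fun k =>
    (lintegral_ofReal_ne_top_iff_integrable (hmeas k) (ae_of_all _ (hnn k))).mp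
      ((hlint k).trans_lt ENNReal.ofReal_lt_top).ne
  have hint : ∀ k : ℕ, ∫ x, |f k x| * (1 + ‖(Θ.M z (t - k * γ)).symm (x - z)‖) ^ l ≤
      C * (b * v * 2 ^ (-((k : ℝ) * γ * (δ - 1)))) := fun k => by
    rw [integral_eq_lintegral_of_nonneg_ae (ae_of_all _ (hnn k)) (hmeas k)]
    exact ENNReal.toReal_le_of_le_ofReal (by positivity) (hlint k)
  choose φ hφm hφ0 hφb hφv using fun k : ℕ =>
    hmatch (Θ.M z (t - k * γ)) z (f k) (hfm k) (hfi k)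
  have hgv : ∀ u ∈ polyFns n l, Integrable fun x => g x * u x := fun u hu => by
    have e1 : Integrable fun x => (Θ.θ z (t - (0 : ℕ) * γ)).indicator g x * u x := by
      refine integrable_mul_polyFns_of_support hu (Θ.M z (t - (0 : ℕ) * γ)) z
        (hgm.indicator (hE 0)) ?_ fun x hx => indicator_of_notMem hx _
      rw [integrable_indicator_iff (hE 0)]
      simpa using hgi
    have e2 := integrable_mul_polyFns hu _ z (hfm 0) (hfi 0)
    refine (e1.add e2).congr (ae_of_all _ fun x => ?_)
    simp only [Pi.add_apply, f, ← add_mul]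
    rw [indicator_self_add_compl_apply]
  refine ⟨φ, hφm, fun k x hx => hφ0 k x hx, fun k x => ?_, fun k α hα => ?_⟩
  · refine (hφb k x).trans ?_
    have hvol := Θ.le_volume_θ_sub z z t (k * γ)
    rw [← hv] at hvol
    have hk : (2 : ℝ) ^ (-((k : ℝ) * γ * (δ - 1))) =
        2 ^ (-((k : ℝ) * γ * δ)) * 2 ^ ((k : ℝ) * γ) := by
      rw [← Real.rpow_add two_pos]
      congr 1
      ring
    have hp : (0 : ℝ) < 2 ^ ((k : ℝ) * γ) := by positivity
    calc _ ≤ K / (Θ.a₁ / Θ.a₂ * v * 2 ^ ((k : ℝ) * γ)) *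
          (C * (b * v * 2 ^ (-((k : ℝ) * γ * (δ - 1))))) := by
          gcongr
          · exact hvol
          · exact hint k
      _ = K * C * (Θ.a₂ / Θ.a₁) * (b * 2 ^ (-((k : ℝ) * γ * δ))) := by
          rw [hk]
          field_simp
      _ ≤ _ := by
          gcongr
          exact le_add_of_nonneg_left hC
  · set m : Euc n → ℝ := fun x => ∏ i, (x i) ^ (α i)
    have hm : m ∈ polyFns n l := monomial_mem_polyFns α hα
    have i1 : Integrable fun x => (Θ.θ z (t - k * γ)).indicator g x * m x := by
      refine ((hgv m hm).indicator (hE k)).congr (ae_of_all _ fun x => ?_)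
      exact indicator_mul_left _ _ _
    have i2 : Integrable fun x => φ k x * m x := by
      refine integrable_mul_polyFns_of_support hm _ z (hφm k) ?_ (hφ0 k)
      have hon : IntegrableOn (φ k) (Θ.θ z (t - k * γ)) :=
        Measure.integrableOn_of_bounded (Θ.volume_θ_ne_top _ _) (hφm k).aestronglyMeasurable
          (ae_of_all _ (hφb k))
      exact (integrableOn_iff_integrable_of_support_subset fun x hx =>
        by_contra fun h => hx (hφ0 k x h)).mp hon
    have i3 := integrable_mul_polyFns hm _ z (hfm k) (hfi k)
    refine ⟨(i1.add i2).congr (ae_of_all _ fun x => (add_mul _ _ _).symm), ?_⟩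
    simp only [add_mul]
    rw [integral_add i1 i2, hφv k m hm, ← integral_add i1 i3]
    refine (integral_congr_ae (ae_of_all _ fun x => ?_)).trans (hmom α hα)
    simp only [f, ← add_mul]
    rw [indicator_self_add_compl_apply]

end EllipsoidCover

lemma eLpNorm_le_of_bound_of_support {α : Type*} [MeasurableSpace α] {μ : Measure α} {s : Set α}
    (hs : μ s ≠ ∞) {f : α → ℝ} {q : ℝ≥0∞} {c : ℝ} (hf : ∀ x, |f x| ≤ c)
    (hfs : ∀ x ∉ s, f x = 0) :
    eLpNorm f q μ ≤ ENNReal.ofReal (c * (μ s).toReal ^ (1 / q.toReal)) := by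
  rw [← eLpNorm_restrict_eq_of_support_subset (s := s) fun x hx =>
    by_contra fun h => hx (hfs x h)]
  refine (eLpNorm_le_of_ae_bound (ae_of_all _ hf)).trans_eq ?_
  rw [Measure.restrict_apply_univ, mul_comm c, ENNReal.ofReal_mul (by positivity), one_div,
    ← ENNReal.ofReal_rpow_of_nonneg ENNReal.toReal_nonneg (inv_nonneg.mpr ENNReal.toReal_nonneg),
    ENNReal.ofReal_toReal hs]

namespace EllipsoidCover

variable {n : ℕ} {Θ : EllipsoidCover n}

lemma one_lt_mul_of_Np_le {p δ : ℝ} {l : ℕ} (hp : 0 < p) (hl : Θ.Np p ≤ (l : ℤ))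
    (hδ : Θ.a₄ * l + 1 < δ) : 1 < δ * p := by
  have h6 := Θ.ha₆
  have h1 : (max 1 Θ.a₄ * n + 1) / (Θ.a₆ * p) < l :=
    (Int.lt_floor_add_one _).trans_le (by unfold Np at hl; exact_mod_cast hl)
  rw [div_lt_iff₀ (by positivity)] at h1
  have h2 : 0 ≤ max 1 Θ.a₄ * n := by positivity
  have h3 : Θ.a₆ * (l * p) ≤ Θ.a₄ * (l * p) := by
    gcongr
    exact Θ.a₆_le_a₄
  have h4 : (Θ.a₄ * l + 1) * p < δ * p := by gcongr
  linarith

/-- The size of a molecule on a dilated ellipsoid, in terms of the normalization of atoms. -/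
lemma volume_rpow_le {p b δ γ : ℝ} {q : ℝ≥0∞} (hp : 0 < p) (hb : 0 ≤ b) (z : Euc n) (t : ℝ)
    (k : ℕ) :
    b * (volume (Θ.θ z t)).toReal ^ (-(1 / p)) * 2 ^ (-((k : ℝ) * γ * δ)) *
        (volume (Θ.θ z (t - k * γ))).toReal ^ (1 / q.toReal) ≤
      b * (Θ.a₂ / Θ.a₁) ^ (1 / p) * 2 ^ (-((k : ℝ) * γ * (δ - 1 / p))) *
        (volume (Θ.θ z (t - k * γ))).toReal ^ (1 / q.toReal - 1 / p) := by
  have h1 := Θ.ha₁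
  have h2 := Θ.ha₂
  have hv := Θ.volume_θ_pos z t
  have hw := Θ.volume_θ_pos z (t - k * γ)
  have hle := Θ.volume_θ_sub_le z z t (k * γ)
  set v := (volume (Θ.θ z t)).toReal
  set w := (volume (Θ.θ z (t - k * γ))).toReal
  have hR : 0 < Θ.a₂ / Θ.a₁ := by positivity
  have h3 := Real.rpow_le_rpow_of_nonpos hw hle (neg_nonpos.mpr (one_div_pos.mpr hp).le)
  rw [Real.mul_rpow (by positivity) (by positivity), Real.mul_rpow hR.le hv.le,
    ← Real.rpow_mul two_pos.le] at h3
  have h4 : (2 : ℝ) ^ (-((k : ℝ) * γ * δ)) =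
      2 ^ (-((k : ℝ) * γ * (δ - 1 / p))) * 2 ^ ((k : ℝ) * γ * -(1 / p)) := by
    rw [← Real.rpow_add two_pos]
    congr 1
    ring
  have h5 : (Θ.a₂ / Θ.a₁) ^ (1 / p) * (Θ.a₂ / Θ.a₁) ^ (-(1 / p)) = 1 := by
    rw [← Real.rpow_add hR, add_neg_cancel, Real.rpow_zero]
  rw [sub_eq_add_neg (1 / q.toReal), Real.rpow_add hw]
  calc _ = b * (Θ.a₂ / Θ.a₁) ^ (1 / p) * 2 ^ (-((k : ℝ) * γ * (δ - 1 / p))) *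
        (w ^ (1 / q.toReal) * ((Θ.a₂ / Θ.a₁) ^ (-(1 / p)) * v ^ (-(1 / p)) *
          2 ^ ((k : ℝ) * γ * -(1 / p)))) := by
        rw [h4]
        linear_combination (-(b * v ^ (-(1 / p)) * w ^ (1 / q.toReal) *
          2 ^ (-((k : ℝ) * γ * (δ - 1 / p))) * 2 ^ ((k : ℝ) * γ * -(1 / p)))) * h5
    _ ≤ _ := by gcongr

lemma integrableOn_of_eLpNorm_le {g : Euc n → ℝ} {z : Euc n} {t c : ℝ} {q : ℝ≥0∞}
    (hq : 1 ≤ q) (hg : Measurable g)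
    (h : eLpNorm g q (volume.restrict (Θ.θ z t)) ≤ ENNReal.ofReal c) :
    IntegrableOn g (Θ.θ z t) := by
  have := isFiniteMeasure_restrict.mpr (Θ.volume_θ_ne_top z t)
  exact MemLp.integrable hq ⟨hg.aestronglyMeasurable, h.trans_lt ENNReal.ofReal_lt_top⟩

end EllipsoidCover

/-- (Molecules are in `H^p`.)  Let `Θ` be a continuous ellipsoid
cover with `γ > 0` as usual, `(p,q,l)` admissible, `δ > a₄ l + 1` and `A > 0`.  There
is `C > 0` so that whenever a measurable `g` satisfies, for some ellipsoid `θ_{z,t}`: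
(1) `‖g‖_{L^q(θ_{z,t})} ≤ A |θ_{z,t}|^{1/q − 1/p}`;
(2) `|g(x)| ≤ A |θ_{z,t}|^{−1/p} 2^{−kγδ}` on `θ_{z,t−(k+1)γ} ∖ θ_{z,t−kγ}` for `k ∈ ℕ₀`;
(3) vanishing moments of orders `≤ l`;
then `g = Σ λ_j a_j` with `(p,q,l)`-atoms `a_j`, convergence in `L¹`, and
`(Σ |λ_j|^p)^{1/p} ≤ C`, i.e. `Σ |λ_j|^p ≤ C^p`. -/
theorem stmt15 (n : ℕ) (Θ : EllipsoidCover n) (γ : ℝ) (hγ : 0 < γ)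
    (hincl : ∀ (x y : Euc n) (t s : ℝ), t ≤ s → (Θ.θ x t ∩ Θ.θ y s).Nonempty →
      Θ.θ y s ⊆ Θ.θ x (t - γ))
    (p : ℝ) (q : ℝ≥0∞) (l : ℕ) (hp0 : 0 < p) (hp1 : p ≤ 1) (hq1 : 1 ≤ q)
    (hpq : ENNReal.ofReal p < q) (hl : Θ.Np p ≤ (l : ℤ))
    (δ : ℝ) (hδ : Θ.a₄ * l + 1 < δ) (A : ℝ) (hA : 0 < A) :
    ∃ C : ℝ, 0 < C ∧
      ∀ (g : Euc n → ℝ) (z : Euc n) (t : ℝ), Measurable g →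
      eLpNorm g q (volume.restrict (Θ.θ z t)) ≤
        ENNReal.ofReal (A * (volume (Θ.θ z t)).toReal ^ (1 / q.toReal - 1 / p)) →
      (∀ k : ℕ, ∀ x ∈ Θ.θ z (t - ((k : ℝ) + 1) * γ) \ Θ.θ z (t - (k : ℝ) * γ),
        |g x| ≤ A * (volume (Θ.θ z t)).toReal ^ (-(1 / p)) * 2 ^ (-((k : ℝ) * γ * δ))) →
      (∀ α : Fin n → ℕ, (∑ i, α i) ≤ l →
        ∫ x : Euc n, g x * ∏ i, (x i) ^ (α i) = 0) →
      ∃ (a : ℕ → Euc n → ℝ) (c : ℕ → ℝ),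
        (∀ j, IsPQLAtom Θ p q l (a j)) ∧
        Summable (fun j => |c j| ^ p) ∧ (∑' j, |c j| ^ p) ≤ C ^ p ∧
        Filter.Tendsto
          (fun m : ℕ =>
            eLpNorm (fun x => g x - ∑ j ∈ Finset.range m, c j * a j x) 1 volume)
          Filter.atTop (nhds 0) := by
  have h1 := Θ.ha₁
  have h2 := Θ.ha₂
  have hmono := fun z t => EllipsoidCover.θ_sub_mono hincl z t
  obtain ⟨C, hC, H⟩ := EllipsoidCover.exists_truncation Θ hγ l hδ
  have hδp : 1 < δ * p := EllipsoidCover.one_lt_mul_of_Np_le hp0 hl hδ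
  have hδ1 : 1 < δ := lt_of_le_of_lt (le_add_of_nonneg_left
    (mul_nonneg Θ.ha₄.le (Nat.cast_nonneg l))) hδ
  set R := Θ.a₂ / Θ.a₁
  have hR0 : 0 < R := by positivity
  -- the bound on the pieces, and the coefficients of the atoms
  set B : ℝ := A * ((1 + 2 * C) * 2 ^ (γ * δ)) with hB
  have hB0 : 0 < B := by positivity
  set D : ℝ := B * R ^ (1 / p)
  have hD0 : 0 < D := by positivity
  let c : ℕ → ℝ := fun k => D * 2 ^ (-((k : ℝ) * γ * (δ - 1 / p)))
  have hc0 : ∀ k, 0 < c k := fun k => by positivity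
  set r : ℝ := 2 ^ (-(γ * (δ * p - 1)))
  have hr0 : 0 ≤ r := by positivity
  have hr1 : r < 1 := Real.rpow_lt_one_of_one_lt_of_neg one_lt_two
    (neg_lt_zero.mpr (mul_pos hγ (by linarith)))
  have hcp : ∀ k, |c k| ^ p = D ^ p * r ^ k := fun k => by
    rw [abs_of_pos (hc0 k), Real.mul_rpow hD0.le (by positivity), ← Real.rpow_mul two_pos.le,
      ← Real.rpow_mul_natCast two_pos.le]
    congr 2
    field_simp
  have hS0 : 0 < (1 - r)⁻¹ := inv_pos.mpr (by linarith)
  refine ⟨D * ((1 - r)⁻¹) ^ (1 / p), by positivity, fun g z t hgm hgq hg hmom => ?_⟩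
  set v := (volume (Θ.θ z t)).toReal
  have hv : 0 < v := Θ.volume_θ_pos z t
  set b : ℝ := A * v ^ (-(1 / p))
  have hb : 0 < b := by positivity
  obtain ⟨htail, φ, hφm, hφ0, hφb, hφv⟩ := H g z t b hb.le hgm
    (EllipsoidCover.integrableOn_of_eLpNorm_le hq1 hgm hgq) hg hmom
  let E : ℕ → Set (Euc n) := fun k => Θ.θ z (t - k * γ)
  have hEm : ∀ k, MeasurableSet (E k) := fun k => Θ.measurableSet_θ _ _
  have hEt : ∀ k, volume (E k) ≠ ∞ := fun k => Θ.volume_θ_ne_top _ _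
  let G : ℕ → Euc n → ℝ := fun k x => (E k).indicator g x + φ k x
  have hG0 : ∀ k, ∀ x ∉ E k, G k x = 0 := fun k x hx => by
    simp only [G, indicator_of_notMem hx, hφ0 k x hx, add_zero]
  let F : ℕ → Euc n → ℝ := fun k => Nat.casesOn k 0 G
  let h : ℕ → Euc n → ℝ := fun k x => F (k + 1) x - F k x
  have hh0 : ∀ k, ∀ x ∉ E k, h k x = 0 := fun k x hx => by
    cases k with
    | zero => simp [h, F, hG0 0 x hx]
    | succ k =>
      have hx' : x ∉ E k := fun h' => hx (hmono z t k.le_succ h')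
      simp only [h, F, hG0 _ x hx, hG0 _ x hx', sub_zero]
  have hhq : ∀ k, eLpNorm (h k) q volume ≤
      ENNReal.ofReal (c k * (volume (E k)).toReal ^ (1 / q.toReal - 1 / p)) := fun k => by
    have hkey := EllipsoidCover.volume_rpow_le (Θ := Θ) (γ := γ) (δ := δ) (q := q) hp0 hB0.le z t k
    refine le_trans ?_ (ENNReal.ofReal_le_ofReal hkey)
    cases k with
    | zero =>
      have hE0 : E 0 = Θ.θ z t := by simp [E]
      have e1 : eLpNorm ((E 0).indicator g) q volume ≤
          ENNReal.ofReal (A * v ^ (1 / q.toReal - 1 / p)) := by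
        rw [eLpNorm_indicator_eq_eLpNorm_restrict (hEm 0), hE0]
        exact hgq
      have e2 : eLpNorm (φ 0) q volume ≤ ENNReal.ofReal (C * b * v ^ (1 / q.toReal)) := by
        have := eLpNorm_le_of_bound_of_support (hEt 0) (q := q) (hφb 0) (hφ0 0)
        simpa [hE0] using this
      have e3 : h 0 = (E 0).indicator g + φ 0 := by
        ext x
        simp [h, F, G]
      rw [e3]
      refine (eLpNorm_add_le (hgm.indicator (hEm 0)).aestronglyMeasurable
        (hφm 0).aestronglyMeasurable hq1).trans ((add_le_add e1 e2).trans ?_)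
      rw [← ENNReal.ofReal_add (by positivity) (by positivity)]
      refine ENNReal.ofReal_le_ofReal ?_
      have h2γ : (1 : ℝ) ≤ 2 ^ (γ * δ) := Real.one_le_rpow one_le_two (by positivity)
      have hBA : A * (1 + C) ≤ B := by
        refine mul_le_mul_of_nonneg_left ?_ hA.le
        calc 1 + C ≤ (1 + 2 * C) * 1 := by linarith
          _ ≤ _ := by gcongr
      simp only [Nat.cast_zero, zero_mul, neg_zero, Real.rpow_zero, mul_one, sub_zero]
      calc _ = A * (1 + C) * v ^ (-(1 / p)) * v ^ (1 / q.toReal) := by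
            rw [sub_eq_add_neg, Real.rpow_add hv]
            ring
        _ ≤ _ := by gcongr
    | succ k =>
      have hbd : ∀ x, |h (k + 1) x| ≤ B * v ^ (-(1 / p)) * 2 ^ (-(((k + 1 : ℕ) : ℝ) * γ * δ)) := by
        intro x
        have e0 : B * v ^ (-(1 / p)) * 2 ^ (-(((k + 1 : ℕ) : ℝ) * γ * δ)) =
            (1 + 2 * C) * (b * 2 ^ (-((k : ℝ) * γ * δ))) := by
          have : (2 : ℝ) ^ (γ * δ) * 2 ^ (-(((k + 1 : ℕ) : ℝ) * γ * δ)) =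
              2 ^ (-((k : ℝ) * γ * δ)) := by
            rw [← Real.rpow_add two_pos]
            congr 1
            push_cast
            ring
          rw [← this, hB]
          ring
        have e1 : |(E (k + 1)).indicator g x - (E k).indicator g x| ≤
            b * 2 ^ (-((k : ℝ) * γ * δ)) := by
          have hp' : 0 ≤ b * 2 ^ (-((k : ℝ) * γ * δ)) := by positivity
          by_cases hx : x ∈ E k
          · have hx' : x ∈ E (k + 1) := hmono z t k.le_succ hx
            simpa [hx, hx'] using hp'
          · by_cases hx' : x ∈ E (k + 1)
            · rw [indicator_of_notMem hx, indicator_of_mem hx', sub_zero]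
              refine hg k x ⟨?_, hx⟩
              simpa [E] using hx'
            · simpa [hx, hx'] using hp'
        have e2 : |φ (k + 1) x| ≤ C * (b * 2 ^ (-((k : ℝ) * γ * δ))) := by
          refine (hφb (k + 1) x).trans ?_
          have : 0 < δ := by linarith
          gcongr
          · exact one_le_two
          · exact k.le_succ
        have e3 := hφb k x
        have e4 : h (k + 1) x = ((E (k + 1)).indicator g x - (E k).indicator g x) +
            φ (k + 1) x - φ k x := by
          simp only [h, F, G]
          ring
        rw [e0, e4]
        refine (abs_sub _ _).trans ((add_le_add_left (abs_add_le _ _) _).trans ?_)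
        linarith
      exact eLpNorm_le_of_bound_of_support (hEt (k + 1)) hbd (hh0 (k + 1))
  have hhv : ∀ k, ∀ α : Fin n → ℕ, (∑ i, α i) ≤ l →
      ∫ y : Euc n, h k y * ∏ i, (y i) ^ (α i) = 0 := fun k α hα => by
    have hF : ∀ k, Integrable (fun y : Euc n => F k y * ∏ i, (y i) ^ (α i)) ∧
        ∫ y : Euc n, F k y * ∏ i, (y i) ^ (α i) = 0 := fun k => by
      cases k with
      | zero => simp [F]
      | succ k => exact hφv k α hα
    simp only [h, sub_mul]
    have hsub := integral_sub (hF (k + 1)).1 (hF k).1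
    rw [(hF (k + 1)).2, (hF k).2, sub_zero] at hsub
    exact hsub
  refine ⟨fun k x => (c k)⁻¹ * h k x, c, fun k => ⟨z, t - k * γ, fun x hx => ?_, ?_,
    fun α hα => ?_⟩, ?_, ?_, ?_⟩
  · by_contra hx'
    exact hx (by simp only [hh0 k x hx', mul_zero])
  · have e1 : eLpNorm (fun x => (c k)⁻¹ * h k x) q volume =
        ENNReal.ofReal (c k)⁻¹ * eLpNorm (h k) q volume := by
      have := eLpNorm_const_smul (c k)⁻¹ (h k) q volume
      rwa [Real.enorm_eq_ofReal (inv_pos.mpr (hc0 k)).le] at this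
    rw [e1]
    refine (mul_le_mul_right (hhq k) _).trans_eq ?_
    rw [← ENNReal.ofReal_mul (inv_pos.mpr (hc0 k)).le, inv_mul_cancel_left₀ (hc0 k).ne']
  · simp only [mul_assoc]
    rw [integral_const_mul, hhv k α hα, mul_zero]
  · simp only [hcp]
    exact (summable_geometric_of_lt_one hr0 hr1).mul_left _
  · simp only [hcp]
    rw [tsum_mul_left, tsum_geometric_of_lt_one hr0 hr1, Real.mul_rpow hD0.le (by positivity),
      ← Real.rpow_mul hS0.le, one_div_mul_cancel hp0.ne', Real.rpow_one]
  · have hsum : ∀ (m : ℕ) (x : Euc n),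
        ∑ j ∈ Finset.range m, c j * ((c j)⁻¹ * h j x) = F m x := fun m x => by
      simp only [mul_inv_cancel_left₀ (hc0 _).ne', h]
      rw [Finset.sum_range_sub fun k => F k x]
      simp [F]
    simp only [hsum]
    rw [← tendsto_add_atTop_iff_nat 1]
    set s : ℝ := 2 ^ (-(γ * (δ - 1)))
    have hs1 : s < 1 := Real.rpow_lt_one_of_one_lt_of_neg one_lt_two
      (neg_lt_zero.mpr (mul_pos hγ (by linarith)))
    have hpow : ∀ m : ℕ, (2 : ℝ) ^ (-((m : ℝ) * γ * (δ - 1))) = s ^ m := fun m => by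
      rw [← Real.rpow_mul_natCast two_pos.le]
      congr 1
      ring
    have hbound : ∀ m : ℕ, eLpNorm (fun x => g x - F (m + 1) x) 1 volume ≤
        ENNReal.ofReal ((C * (b * v) + C * b * (R * v)) * s ^ m) := fun m => by
      have e1 : (fun x => g x - F (m + 1) x) = (E m)ᶜ.indicator g - φ m := by
        ext x
        have := indicator_self_add_compl_apply (E m) g x
        simp only [F, G, Pi.sub_apply]
        linarith
      have e2 : eLpNorm ((E m)ᶜ.indicator g) 1 volume ≤ ENNReal.ofReal (C * (b * v) * s ^ m) := by
        rw [eLpNorm_indicator_eq_eLpNorm_restrict (hEm m).compl, eLpNorm_one_eq_lintegral_enorm,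
          ← hpow, mul_assoc C]
        simpa only [Real.enorm_eq_ofReal_abs] using htail m
      have e3 : eLpNorm (φ m) 1 volume ≤ ENNReal.ofReal (C * b * (R * v) * s ^ m) := by
        refine (eLpNorm_le_of_bound_of_support (hEt m) (hφb m) (hφ0 m)).trans
          (ENNReal.ofReal_le_ofReal ?_)
        rw [ENNReal.toReal_one, div_one, Real.rpow_one]
        calc _ ≤ C * (b * 2 ^ (-((m : ℝ) * γ * δ))) * (R * v * 2 ^ ((m : ℝ) * γ)) := by
              gcongr
              exact Θ.volume_θ_sub_le z z t (m * γ)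
          _ = C * b * (R * v) * (2 ^ (-((m : ℝ) * γ * δ)) * 2 ^ ((m : ℝ) * γ)) := by ring
          _ = _ := by
              rw [← Real.rpow_add two_pos, ← hpow]
              congr 2
              ring
      rw [e1, add_mul, ENNReal.ofReal_add (by positivity) (by positivity)]
      exact (eLpNorm_sub_le (hgm.indicator (hEm m).compl).aestronglyMeasurable
        (hφm m).aestronglyMeasurable le_rfl).trans (add_le_add e2 e3)
    refine tendsto_of_tendsto_of_tendsto_of_le_of_le tendsto_const_nhds ?_
      (fun _ => zero_le) hbound
    have := ENNReal.tendsto_ofReal ((tendsto_pow_atTop_nhds_zero_of_lt_one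
      (by positivity : 0 ≤ s) hs1).const_mul (C * (b * v) + C * b * (R * v)))
    simpa using this
end
end
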